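/- arXiv:1001.0875 — 3 statements merged into one kernel-verified Lean document; each statement's English description precedes it below -/
import Mathlib

section
/- Let μ be a compactly-supported Borel probability measure on ℝⁿ whose support is not contained in a hyperplane, and let ξ, η ∈ ℝⁿ with ξ ≠ η. Set θ = (ξ − η)/|ξ − η| and R = |ξ − η|. Then the Riemannian length of the straight segment from η to ξ with respect to the metric g_μ(ζ)(u,v) = ∇²Λ_μ(ζ)u·v satisfies ∫₀^R √( ∂_{θθ} Λ_μ(η + tθ) ) dt ≤ √( Λ_μ(2ξ − η) − Λ_μ(η) − 2 ∇Λ_μ(η)·(ξ − η) ). In particular, the Riemannian distance d(ξ, η) between ξ and η with respect to g_μ is at most the right-hand side. -/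
open MeasureTheory Real Set Filter Topology RealInnerProductSpace Matrix
noncomputable section

abbrev EucSp (n : ℕ) := EuclideanSpace ℝ (Fin n)

/-- A nonnegative function is log-concave. -/
def IsLogConcaveFn {n : ℕ} (f : EucSp n → ℝ) : Prop :=
  (∀ x, 0 ≤ f x) ∧ ∀ x y : EucSp n, ∀ l : ℝ, l ∈ Set.Icc (0:ℝ) 1 →
    f x ^ (1 - l) * f y ^ l ≤ f ((1 - l) • x + l • y)

/-- A measure is log-concave if it has a log-concave density w.r.t. Lebesgue measure. -/
def IsLogConcave {n : ℕ} (μ : Measure (EucSp n)) : Prop :=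
  ∃ f : EucSp n → ℝ, IsLogConcaveFn f ∧
    μ = volume.withDensity (fun x => ENNReal.ofReal (f x))

/-- Barycenter at the origin and covariance matrix equal to the identity. -/
def IsIsotropic {n : ℕ} (μ : Measure (EucSp n)) : Prop :=
  (∫ x, x ∂μ = 0) ∧ ∀ u v : EucSp n, (∫ x, ⟪x, u⟫ * ⟪x, v⟫ ∂μ) = ⟪u, v⟫

/-- σ_n² = sup over isotropic log-concave random vectors of E (|X| - √n)². -/
def sigmaNSq (n : ℕ) : ℝ :=
  sSup {v | ∃ μ : Measure (EucSp n), IsProbabilityMeasure μ ∧ IsIsotropic μ ∧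
    IsLogConcave μ ∧ v = ∫ x, (‖x‖ - Real.sqrt n) ^ 2 ∂μ}

def sigmaN (n : ℕ) : ℝ := Real.sqrt (sigmaNSq n)

/-- σ̲_n = (1/√n) sup over isotropic log-concave random vectors of |E X |X|²|. -/
def sigmaBar (n : ℕ) : ℝ :=
  (Real.sqrt n)⁻¹ * sSup {v | ∃ μ : Measure (EucSp n), IsProbabilityMeasure μ ∧
    IsIsotropic μ ∧ IsLogConcave μ ∧ v = ‖∫ x, (‖x‖ ^ 2) • x ∂μ‖}

/-- L_n = sup over isotropic log-concave probability densities f on ℝⁿ of f(0)^{1/n}. -/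
def LN (n : ℕ) : ℝ :=
  sSup {l | ∃ (μ : Measure (EucSp n)) (f : EucSp n → ℝ),
    IsProbabilityMeasure μ ∧ IsIsotropic μ ∧ IsLogConcaveFn f ∧
    μ = volume.withDensity (fun x => ENNReal.ofReal (f x)) ∧
    l = f 0 ^ ((n : ℝ)⁻¹)}

/-- The support of a Borel measure: the minimal closed set of full measure,
i.e. the set of points all of whose neighborhoods have positive measure. -/
def msupport {n : ℕ} (μ : Measure (EucSp n)) : Set (EucSp n) :=
  {x | ∀ U ∈ nhds x, μ U ≠ 0}

/-- μ is compactly supported. -/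
def IsCompactlySupported {n : ℕ} (μ : Measure (EucSp n)) : Prop :=
  ∃ K : Set (EucSp n), IsCompact K ∧ μ Kᶜ = 0

/-- The support of μ is not contained in a hyperplane (an affine hyperplane). -/
def SuppNotInHyperplane {n : ℕ} (μ : Measure (EucSp n)) : Prop :=
  ¬ ∃ (θ : EucSp n) (c : ℝ), θ ≠ 0 ∧ msupport μ ⊆ {x | ⟪θ, x⟫ = c}

/-- The logarithmic Laplace transform Λ_μ(ξ) = log ∫ exp(ξ·x) dμ(x). -/
def logLaplace {n : ℕ} (μ : Measure (EucSp n)) (ξ : EucSp n) : ℝ :=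
  Real.log (∫ x, Real.exp ⟪ξ, x⟫ ∂μ)

/-- The Hessian matrix of a function f : ℝⁿ → ℝ at a point ξ. -/
def hessianM {n : ℕ} (f : EucSp n → ℝ) (ξ : EucSp n) : Matrix (Fin n) (Fin n) ℝ :=
  Matrix.of fun i j =>
    fderiv ℝ (fun η => fderiv ℝ f η (EuclideanSpace.single j 1)) ξ
      (EuclideanSpace.single i 1)

/-- Ψ_μ(ξ) = log ( det ∇²Λ_μ(ξ) / det ∇²Λ_μ(0) ). -/
def PsiFn {n : ℕ} (μ : Measure (EucSp n)) (ξ : EucSp n) : ℝ :=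
  Real.log ((hessianM (logLaplace μ) ξ).det / (hessianM (logLaplace μ) 0).det)

/-- Second directional derivative ∂_{uu} f (p). -/
def dirDeriv2 {n : ℕ} (f : EucSp n → ℝ) (p u : EucSp n) : ℝ :=
  fderiv ℝ (fun q => fderiv ℝ f q u) p u

/-- Riemannian length of a path γ : [0,1] → ℝⁿ with respect to the Hessian metric of f. -/
def pathRiemLength {n : ℕ} (f : EucSp n → ℝ) (γ : ℝ → EucSp n) : ℝ :=
  ∫ t in (0:ℝ)..1, Real.sqrt (dirDeriv2 f (γ t) (deriv γ t))

/-- Riemannian distance with respect to the Hessian metric of f: the infimum of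
Riemannian lengths of C¹ paths joining the two points. -/
def riemDist {n : ℕ} (f : EucSp n → ℝ) (ξ η : EucSp n) : ℝ :=
  sInf {L | ∃ γ : ℝ → EucSp n, ContDiff ℝ 1 γ ∧ γ 0 = η ∧ γ 1 = ξ ∧
    L = pathRiemLength f γ}

open scoped Convolution ContDiff
open ProbabilityTheory

lemma IsCompactlySupported.exists_ae_norm_le {n : ℕ} {μ : Measure (EucSp n)}
    (hμ : IsCompactlySupported μ) : ∃ C : ℝ, 0 < C ∧ ∀ᵐ x ∂μ, ‖x‖ ≤ C := by
  obtain ⟨K, hK, hKμ⟩ := hμ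
  obtain ⟨C, hC, hKC⟩ := hK.isBounded.exists_pos_norm_le
  refine ⟨C, hC, ?_⟩
  have h : ∀ᵐ x ∂μ, x ∈ K := hKμ
  filter_upwards [h] with x hx using hKC x hx

lemma IsCompactlySupported.integrable_exp_inner {n : ℕ} {μ : Measure (EucSp n)}
    [IsFiniteMeasure μ] (hμ : IsCompactlySupported μ) (p : EucSp n) :
    Integrable (fun x => Real.exp ⟪p, x⟫) μ := by
  obtain ⟨C, hC, hμC⟩ := hμ.exists_ae_norm_le
  refine Integrable.of_bound (by fun_prop) (Real.exp (‖p‖ * C)) ?_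
  filter_upwards [hμC] with x hx
  rw [Real.norm_eq_abs, Real.abs_exp, Real.exp_le_exp]
  exact (real_inner_le_norm p x).trans (by gcongr)

lemma IsCompactlySupported.contDiff_integral_exp_inner {n : ℕ} {μ : Measure (EucSp n)}
    [IsFiniteMeasure μ] (hμ : IsCompactlySupported μ) :
    ContDiff ℝ 2 (fun p => ∫ x, Real.exp ⟪p, x⟫ ∂μ) := by
  obtain ⟨C, hC, hμC⟩ := hμ.exists_ae_norm_le
  let χ : ContDiffBump (0 : EucSp n) := ⟨C, C + 1, hC, by linarith⟩
  let g : EucSp n → EucSp n → ℝ := fun p x => χ x * Real.exp (-⟪p, x⟫)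
  have hconv : ContDiffOn ℝ (2 : ℕ∞)
      (fun p => ((fun _ => (1 : ℝ)) ⋆[ContinuousLinearMap.mul ℝ ℝ, μ] g p) 0) univ := by
    refine contDiffOn_convolution_right_with_param_comp (ContinuousLinearMap.mul ℝ ℝ)
      (v := fun _ => 0) contDiffOn_const (g := g) (k := Metric.closedBall 0 (C + 1)) isOpen_univ
      (isCompact_closedBall _ _) ?_ (locallyIntegrable_const 1) ?_
    · intro p x _ hx
      have : χ x = 0 := χ.zero_of_le_dist (by
        simpa only [Metric.mem_closedBall, not_le] using (not_le.mp hx).le)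
      simp [g, this]
    · refine ContDiff.contDiffOn ?_
      have h1 : ContDiff ℝ (2 : ℕ∞) (fun q : EucSp n × EucSp n => χ q.2) :=
        χ.contDiff.comp contDiff_snd
      exact h1.mul (Real.contDiff_exp.comp (contDiff_fst.inner ℝ contDiff_snd).neg)
  rw [← contDiffOn_univ]
  refine hconv.congr fun p _ => ?_
  rw [convolution]
  refine integral_congr_ae ?_
  filter_upwards [hμC] with x hx
  have : χ (-x) = 1 := χ.one_of_mem_closedBall (by simpa using hx)
  simp [g, this]

lemma IsCompactlySupported.contDiff_logLaplace {n : ℕ} {μ : Measure (EucSp n)}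
    [IsProbabilityMeasure μ] (hμ : IsCompactlySupported μ) : ContDiff ℝ 2 (logLaplace μ) :=
  hμ.contDiff_integral_exp_inner.log fun p => (integral_exp_pos (hμ.integrable_exp_inner p)).ne'

lemma hasDerivAt_comp_line {n : ℕ} {f : EucSp n → ℝ} (hf : Differentiable ℝ f)
    (p u : EucSp n) (t : ℝ) :
    HasDerivAt (fun s : ℝ => f (p + s • u)) (fderiv ℝ f (p + t • u) u) t := by
  have h : HasDerivAt (fun s : ℝ => p + s • u) u t := by
    simpa using ((hasDerivAt_id t).smul_const u).const_add p
  exact (hf (p + t • u)).hasFDerivAt.comp_hasDerivAt t h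

lemma contDiff_fderiv_apply_const {n : ℕ} {f : EucSp n → ℝ} (hf : ContDiff ℝ 2 f) (u : EucSp n) :
    ContDiff ℝ 1 (fun q => fderiv ℝ f q u) :=
  (hf.fderiv_right (by norm_num)).clm_apply contDiff_const

lemma continuous_dirDeriv2 {n : ℕ} {f : EucSp n → ℝ} (hf : ContDiff ℝ 2 f) (u : EucSp n) :
    Continuous (fun p => dirDeriv2 f p u) :=
  ((contDiff_fderiv_apply_const hf u).continuous_fderiv one_ne_zero).clm_apply continuous_const

lemma IsCompactlySupported.dirDeriv2_logLaplace_nonneg {n : ℕ} {μ : Measure (EucSp n)}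
    [IsProbabilityMeasure μ] (hμ : IsCompactlySupported μ) (p u : EucSp n) :
    0 ≤ dirDeriv2 (logLaplace μ) p u := by
  have hint := hμ.integrable_exp_inner
  have hexp : ∀ s : ℝ, ∀ x : EucSp n,
      Real.exp (⟪p, x⟫ + s * ⟪u, x⟫) = Real.exp ⟪p + s • u, x⟫ := fun s x => by
    rw [inner_add_left, real_inner_smul_left]
  let ν := μ.tilted (fun x => ⟪p, x⟫)
  let X : EucSp n → ℝ := fun x => ⟪u, x⟫
  have hline : (fun s : ℝ => logLaplace μ (p + s • u)) = fun s => logLaplace μ p + cgf X ν s := by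
    ext s
    have h : (∫ x, Real.exp (s * X x) ∂ν)
        = (∫ x, Real.exp ⟪p + s • u, x⟫ ∂μ) / ∫ x, Real.exp ⟪p, x⟫ ∂μ := by
      rw [integral_exp_tilted]
      simp only [Pi.add_apply, X, hexp]
    rw [cgf, mgf, h, Real.log_div (integral_exp_pos (hint _)).ne' (integral_exp_pos (hint _)).ne']
    simp only [logLaplace]
    ring
  have hset : integrableExpSet X ν = univ := by
    refine eq_univ_of_forall fun s => ?_
    change Integrable (fun x => Real.exp (s * X x)) ν
    rw [integrable_tilted_iff (hint p)]
    simpa only [smul_eq_mul, ← Real.exp_add, X, hexp] using hint (p + s • u)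
  have hf := hμ.contDiff_logLaplace
  have h1 : deriv (fun s : ℝ => logLaplace μ (p + s • u))
      = fun s => fderiv ℝ (logLaplace μ) (p + s • u) u :=
    funext fun s => (hasDerivAt_comp_line (hf.differentiable (by norm_num)) p u s).deriv
  have h2 : deriv (deriv (fun s : ℝ => logLaplace μ (p + s • u))) 0
      = dirDeriv2 (logLaplace μ) p u := by
    rw [h1]
    have := (hasDerivAt_comp_line
      ((contDiff_fderiv_apply_const hf u).differentiable (by norm_num)) p u 0).deriv
    simpa [dirDeriv2] using this
  have h3 : deriv (fun s : ℝ => logLaplace μ (p + s • u)) = deriv (cgf X ν) := by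
    rw [hline]
    exact funext fun s => deriv_const_add _
  rw [← h2, h3]
  have h4 := variance_tilted_mul (X := X) (μ := ν) (t := 0) (by simp [hset])
  rw [iteratedDeriv_succ, iteratedDeriv_one] at h4
  exact h4 ▸ variance_nonneg _ _

/-- Cauchy–Schwarz on an interval. -/
lemma integral_sqrt_le_sqrt_mul_integral {h : ℝ → ℝ} (hc : Continuous h) (h0 : ∀ t, 0 ≤ h t)
    {T : ℝ} (hT : 0 < T) :
    (∫ t in (0 : ℝ)..T, √(h t)) ≤ √(T * ∫ t in (0 : ℝ)..T, h t) := by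
  set I := ∫ t in (0 : ℝ)..T, √(h t) with hI
  have hs : Continuous fun t => √(h t) := hc.sqrt
  have hnn : 0 ≤ ∫ t in (0 : ℝ)..T, (√(h t) - I / T) ^ 2 :=
    intervalIntegral.integral_nonneg hT.le fun t _ => sq_nonneg _
  have hexpand : (∫ t in (0 : ℝ)..T, (√(h t) - I / T) ^ 2)
      = (∫ t in (0 : ℝ)..T, h t) - 2 * (I / T) * I + T * (I / T) ^ 2 := by
    have : ∀ t, (√(h t) - I / T) ^ 2 = h t - 2 * (I / T) * √(h t) + (I / T) ^ 2 := fun t => by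
      rw [sub_sq, Real.sq_sqrt (h0 t)]
      ring
    simp only [this]
    have hlin : Continuous fun t => h t - 2 * (I / T) * √(h t) := hc.sub (hs.const_mul _)
    rw [intervalIntegral.integral_add (hlin.intervalIntegrable _ _)
      intervalIntegrable_const, intervalIntegral.integral_sub (hc.intervalIntegrable _ _)
      ((hs.const_mul _).intervalIntegrable _ _), intervalIntegral.integral_const_mul]
    simp [hI]
  rw [hexpand] at hnn
  refine Real.le_sqrt_of_sq_le ?_
  have : (∫ t in (0 : ℝ)..T, h t) - 2 * (I / T) * I + T * (I / T) ^ 2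
      = (T * (∫ t in (0 : ℝ)..T, h t) - I ^ 2) / T := by
    field_simp
    ring
  rw [this] at hnn
  have := mul_nonneg hnn hT.le
  rw [div_mul_cancel₀ _ hT.ne'] at this
  linarith

lemma integral_sqrt_dirDeriv2_le {n : ℕ} {f : EucSp n → ℝ} (hf : ContDiff ℝ 2 f)
    (hf0 : ∀ p u, 0 ≤ dirDeriv2 f p u) (p u : EucSp n) {T : ℝ} (hT : 0 < T) :
    (∫ t in (0 : ℝ)..T, √(dirDeriv2 f (p + t • u) u)) ≤
      √(f (p + (2 * T) • u) - f p - 2 * T * fderiv ℝ f p u) := by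
  set g : ℝ → ℝ := fun t => f (p + t • u) with hg_def
  set g' : ℝ → ℝ := fun t => fderiv ℝ f (p + t • u) u with hg'_def
  set g'' : ℝ → ℝ := fun t => dirDeriv2 f (p + t • u) u
  have hg : ∀ t, HasDerivAt g (g' t) t :=
    hasDerivAt_comp_line (hf.differentiable (by norm_num)) p u
  have hg' : ∀ t, HasDerivAt g' (g'' t) t :=
    hasDerivAt_comp_line ((contDiff_fderiv_apply_const hf u).differentiable (by norm_num)) p u
  have hg'' : Continuous g'' := (continuous_dirDeriv2 hf u).comp (by fun_prop)
  have hmono : Monotone g' := monotone_of_hasDerivAt_nonneg hg' fun t => hf0 _ _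
  have hconv : ConvexOn ℝ univ g := by
    refine Monotone.convexOn_univ_of_deriv (fun t => (hg t).differentiableAt) ?_
    rwa [show deriv g = g' from funext fun t => (hg t).deriv]
  have hftc : (∫ t in (0 : ℝ)..T, g'' t) = g' T - g' 0 :=
    intervalIntegral.integral_eq_sub_of_hasDerivAt (fun t _ => hg' t) (hg''.intervalIntegrable _ _)
  have tangent : ∀ a b : ℝ, a < b → (b - a) * g' a ≤ g b - g a := fun a b hab => by
    have := hconv.le_slope_of_hasDerivAt (mem_univ a) (mem_univ b) hab (hg a)
    rw [slope_def_field, le_div_iff₀ (sub_pos.mpr hab)] at this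
    linarith
  have h1 := tangent 0 T hT
  have h2 := tangent T (2 * T) (by linarith)
  refine (integral_sqrt_le_sqrt_mul_integral hg'' (fun t => hf0 _ _) hT).trans
    (Real.sqrt_le_sqrt ?_)
  have e0 : g 0 = f p := by simp [g]
  have e1 : g' 0 = fderiv ℝ f p u := by simp [g']
  rw [hftc, ← e0, ← e1]
  change _ ≤ g (2 * T) - _ - _
  linarith

lemma riemDist_le_pathRiemLength {n : ℕ} (f : EucSp n → ℝ) {ξ η : EucSp n} {γ : ℝ → EucSp n}
    (hγ : ContDiff ℝ 1 γ) (h0 : γ 0 = η) (h1 : γ 1 = ξ) :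
    riemDist f ξ η ≤ pathRiemLength f γ := by
  refine csInf_le ⟨0, ?_⟩ ⟨γ, hγ, h0, h1, rfl⟩
  rintro _ ⟨_, _, _, _, rfl⟩
  exact intervalIntegral.integral_nonneg zero_le_one fun t _ => Real.sqrt_nonneg _

/-- For a compactly-supported probability measure μ whose support is not contained in a
hyperplane and ξ ≠ η, with θ = (ξ−η)/|ξ−η| and R = |ξ−η|, the Riemannian length of the
straight segment from η to ξ in the Hessian metric of Λ_μ is at most
√( Λ_μ(2ξ−η) − Λ_μ(η) − 2∇Λ_μ(η)·(ξ−η) ); in particular d(ξ,η) is at most this bound. -/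
theorem riemannian_dist_bound_logLaplace (n : ℕ) (μ : Measure (EucSp n))
    (hprob : IsProbabilityMeasure μ) (hcpt : IsCompactlySupported μ)
    (hhyp : SuppNotInHyperplane μ) (ξ η : EucSp n) (hne : ξ ≠ η)
    (θ : EucSp n) (hθ : θ = ‖ξ - η‖⁻¹ • (ξ - η)) (R : ℝ) (hR : R = ‖ξ - η‖) :
    (∫ t in (0:ℝ)..R, Real.sqrt (dirDeriv2 (logLaplace μ) (η + t • θ) θ)) ≤
        Real.sqrt (logLaplace μ ((2:ℝ) • ξ - η) - logLaplace μ η -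
          2 * ⟪gradient (logLaplace μ) η, ξ - η⟫) ∧
      riemDist (logLaplace μ) ξ η ≤
        Real.sqrt (logLaplace μ ((2:ℝ) • ξ - η) - logLaplace μ η -
          2 * ⟪gradient (logLaplace μ) η, ξ - η⟫) := by
  have hf := hcpt.contDiff_logLaplace
  have hf0 := hcpt.dirDeriv2_logLaplace_nonneg
  have hpos : 0 < ‖ξ - η‖ := norm_pos_iff.mpr (sub_ne_zero.mpr hne)
  have hgrad : ⟪gradient (logLaplace μ) η, ξ - η⟫ = fderiv ℝ (logLaplace μ) η (ξ - η) := by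
    rw [gradient, InnerProductSpace.toDual_symm_apply]
  have hend : (2 : ℝ) • ξ - η = η + (2 : ℝ) • (ξ - η) := by module
  rw [hgrad, hend]
  constructor
  · have hRθ : R • θ = ξ - η := by
      rw [hR, hθ, smul_smul, mul_inv_cancel₀ hpos.ne', one_smul]
    have := integral_sqrt_dirDeriv2_le hf hf0 η θ (hR ▸ hpos)
    rwa [mul_smul, mul_assoc, ← smul_eq_mul R, ← map_smul, hRθ] at this
  · have hderiv : deriv (fun t : ℝ => η + t • (ξ - η)) = fun _ => ξ - η := funext fun t => by
      simpa using (((hasDerivAt_id t).smul_const (ξ - η)).const_add η).deriv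
    refine (riemDist_le_pathRiemLength (logLaplace μ) (γ := fun t => η + t • (ξ - η))
      (by fun_prop) (by simp) (by simp)).trans ?_
    have := integral_sqrt_dirDeriv2_le hf hf0 η (ξ - η) one_pos
    simpa only [pathRiemLength, hderiv, mul_one] using this
end
end

section
/- Let μ be a compactly-supported Borel probability measure on ℝⁿ whose support is not contained in a hyperplane and whose barycenter lies at the origin. Then for every ξ ∈ ℝⁿ with ξ ≠ 0, writing θ = ξ/|ξ|, the Riemannian length of the straight segment from 0 to ξ with respect to the metric g_μ(ζ)(u,v) = ∇²Λ_μ(ζ)u·v satisfies ∫₀^{|ξ|} √( ∂_{θθ} Λ_μ(tθ) ) dt ≤ √( Λ_μ(2ξ) ); in particular the Riemannian distance satisfies d(ξ, 0) ≤ √( Λ_μ(2ξ) ). -/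
open MeasureTheory Real Set Filter Topology RealInnerProductSpace Matrix
noncomputable section

/-- For `f` with `f 0 = 0`, `f' 0 = 0` and continuous `f'' ≥ 0`,
the integral of `√f''` over `[0, T]` is at most `√(f (2 * T))`. -/
lemma integral_sqrt_second_deriv_le {f f' f'' : ℝ → ℝ} (hf : ∀ t, HasDerivAt f (f' t) t)
    (hf' : ∀ t, HasDerivAt f' (f'' t) t) (hcont : Continuous f'') (hnonneg : ∀ t, 0 ≤ f'' t)
    (h0 : f 0 = 0) (h0' : f' 0 = 0) {T : ℝ} (hT : 0 ≤ T) :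
    ∫ t in (0:ℝ)..T, √(f'' t) ≤ √(f (2 * T)) := by
  rcases hT.eq_or_lt with rfl | hT
  · simp
  have hmono : Monotone f' := monotone_of_hasDerivAt_nonneg hf' hnonneg
  have hfc : Continuous f := continuous_iff_continuousAt.mpr fun t ↦ (hf t).continuousAt
  have hA : ∫ t in (0:ℝ)..T, f'' t = f' T := by
    rw [intervalIntegral.integral_eq_sub_of_hasDerivAt (fun t _ ↦ hf' t)
      (hcont.intervalIntegrable _ _), h0', sub_zero]
  have hB : T * f' T ≤ f (2 * T) := by
    obtain ⟨a, ha, ha'⟩ := exists_hasDerivAt_eq_slope f f' hT hfc.continuousOn fun t _ ↦ hf t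
    obtain ⟨b, hb, hb'⟩ := exists_hasDerivAt_eq_slope f f' (by linarith : T < 2 * T)
      hfc.continuousOn fun t _ ↦ hf t
    have h1 : 0 ≤ f' a := h0' ▸ hmono ha.1.le
    have h2 : f' T ≤ f' b := hmono hb.1.le
    rw [eq_div_iff (by linarith)] at ha' hb'
    nlinarith [mul_nonneg h1 hT.le, mul_le_mul_of_nonneg_right h2 hT.le]
  refine le_of_forall_gt_imp_ge_of_dense fun b hb ↦ ?_
  have hb0 : 0 < b := (Real.sqrt_nonneg _).trans_lt hb
  have hb2 : f (2 * T) ≤ b ^ 2 := (Real.sqrt_le_left hb0.le).mp hb.le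
  have hscaled : Continuous fun t ↦ (2 * (b / T))⁻¹ * f'' t := continuous_const.mul hcont
  calc ∫ t in (0:ℝ)..T, √(f'' t)
      ≤ ∫ t in (0:ℝ)..T, ((2 * (b / T))⁻¹ * f'' t + b / T / 2) := by
        refine intervalIntegral.integral_mono_on hT.le
          (hcont.sqrt.intervalIntegrable _ _)
          ((hscaled.add continuous_const).intervalIntegrable _ _)
          fun t _ ↦ ?_
        have hs := Real.sq_sqrt (hnonneg t)
        have : (2 * (b / T))⁻¹ * f'' t + b / T / 2 - √(f'' t)
            = (2 * (b / T))⁻¹ * (√(f'' t) - b / T) ^ 2 := by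
          rw [sub_sq, hs]; field_simp; ring
        have : 0 ≤ (2 * (b / T))⁻¹ * (√(f'' t) - b / T) ^ 2 := by positivity
        linarith
    _ = (T * f' T) / (2 * b) + b / 2 := by
        rw [intervalIntegral.integral_add (hscaled.intervalIntegrable _ _)
          (continuous_const.intervalIntegrable _ _), intervalIntegral.integral_const_mul, hA,
          intervalIntegral.integral_const, smul_eq_mul]
        field_simp; ring
    _ ≤ b ^ 2 / (2 * b) + b / 2 := by gcongr; exact hB.trans hb2
    _ = b := by field_simp; ring

section LaplaceTransform

variable {n : ℕ} {μ : Measure (EucSp n)}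

lemma IsCompactlySupported.exists_ae_norm_le_s15 (h : IsCompactlySupported μ) :
    ∃ R : ℝ, 0 ≤ R ∧ ∀ᵐ x ∂μ, ‖x‖ ≤ R := by
  obtain ⟨K, hK, hμ⟩ := h
  obtain ⟨R, hR⟩ := hK.isBounded.exists_norm_le
  refine ⟨max R 0, le_max_right _ _, ?_⟩
  filter_upwards [mem_ae_iff.mpr hμ] with x hx
  exact (hR x hx).trans (le_max_left _ _)

lemma norm_mul_exp_inner_le {C R : ℝ} {a : ℝ} {ξ x : EucSp n} (ha : ‖a‖ ≤ C) (hx : ‖x‖ ≤ R) :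
    ‖a * Real.exp ⟪ξ, x⟫‖ ≤ C * Real.exp (‖ξ‖ * R) := by
  rw [norm_mul, Real.norm_of_nonneg (Real.exp_pos _).le]
  have h : ⟪ξ, x⟫ ≤ ‖ξ‖ * R :=
    (real_inner_le_norm _ _).trans (mul_le_mul_of_nonneg_left hx (norm_nonneg _))
  have hC : 0 ≤ C := (norm_nonneg _).trans ha
  gcongr

lemma logLaplace_smul (t : ℝ) (v : EucSp n) :
    logLaplace μ (t • v) = ProbabilityTheory.cgf (fun x ↦ ⟪v, x⟫) μ t := by
  simp [logLaplace, ProbabilityTheory.cgf, ProbabilityTheory.mgf, real_inner_smul_left]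

variable [IsProbabilityMeasure μ]

lemma integrable_mul_exp_inner (hcpt : IsCompactlySupported μ) {g : EucSp n → ℝ}
    (hg : Continuous g) {C : ℝ} (hgC : ∀ᵐ x ∂μ, ‖g x‖ ≤ C) (ξ : EucSp n) :
    Integrable (fun x ↦ g x * Real.exp ⟪ξ, x⟫) μ := by
  obtain ⟨R, -, hR⟩ := hcpt.exists_ae_norm_le_s15
  refine Integrable.of_bound (by fun_prop) (C * Real.exp (‖ξ‖ * R)) ?_
  filter_upwards [hR, hgC] with x hx hgx using norm_mul_exp_inner_le hgx hx

/-- Differentiation under the integral sign for weighted Laplace transforms. -/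
lemma hasFDerivAt_integral_mul_exp_inner (hcpt : IsCompactlySupported μ) {g : EucSp n → ℝ}
    (hg : Continuous g) {C : ℝ} (hgC : ∀ᵐ x ∂μ, ‖g x‖ ≤ C) (ξ : EucSp n) :
    HasFDerivAt (fun η ↦ ∫ x, g x * Real.exp ⟪η, x⟫ ∂μ)
      (∫ x, (g x * Real.exp ⟪ξ, x⟫) • innerSL ℝ x ∂μ) ξ ∧
    Integrable (fun x ↦ (g x * Real.exp ⟪ξ, x⟫) • innerSL ℝ x) μ := by
  obtain ⟨R, hR0, hR⟩ := hcpt.exists_ae_norm_le_s15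
  have hb : ∀ᵐ x ∂μ, ∀ η ∈ Metric.ball ξ 1,
      ‖(g x * Real.exp ⟪η, x⟫) • innerSL ℝ x‖ ≤ C * Real.exp ((‖ξ‖ + 1) * R) * R := by
    filter_upwards [hR, hgC] with x hx hgx η hη
    have hC : 0 ≤ C := (norm_nonneg _).trans hgx
    have hη' : ‖η‖ ≤ ‖ξ‖ + 1 := by
      have := norm_sub_norm_le η ξ
      rw [mem_ball_iff_norm] at hη
      linarith
    rw [norm_smul, innerSL_apply_norm]
    have h := norm_mul_exp_inner_le (ξ := η) hgx hx
    have h' : C * Real.exp (‖η‖ * R) ≤ C * Real.exp ((‖ξ‖ + 1) * R) := by gcongr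
    exact mul_le_mul (h.trans h') hx (norm_nonneg _) (by positivity)
  have hm : AEStronglyMeasurable (fun x ↦ (g x * Real.exp ⟪ξ, x⟫) • innerSL ℝ x) μ :=
    Continuous.aestronglyMeasurable (by fun_prop)
  refine ⟨hasFDerivAt_integral_of_dominated_of_fderiv_le
    (F := fun η x ↦ g x * Real.exp ⟪η, x⟫)
    (F' := fun η x ↦ (g x * Real.exp ⟪η, x⟫) • innerSL ℝ x)
    (bound := fun _ ↦ C * Real.exp ((‖ξ‖ + 1) * R) * R)
    (Metric.ball_mem_nhds ξ one_pos)
    (Eventually.of_forall fun η ↦ Continuous.aestronglyMeasurable (by fun_prop))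
    (integrable_mul_exp_inner hcpt hg hgC ξ) hm hb (integrable_const _)
    (Eventually.of_forall fun x η _ ↦ ?_),
    Integrable.of_bound hm _ (hb.mono fun x hx ↦ hx ξ (Metric.mem_ball_self one_pos))⟩
  have hi : HasFDerivAt (fun η : EucSp n ↦ ⟪η, x⟫) (innerSL ℝ x) η := by
    refine (innerSL ℝ x).hasFDerivAt.congr_of_eventuallyEq (Eventually.of_forall fun η ↦ ?_)
    simp [real_inner_comm]
  simpa [smul_smul] using hi.exp.const_mul (g x)

lemma integral_exp_inner_pos (hcpt : IsCompactlySupported μ) (ξ : EucSp n) :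
    0 < ∫ x, Real.exp ⟪ξ, x⟫ ∂μ := by
  refine integral_exp_pos ?_
  simpa using integrable_mul_exp_inner hcpt (g := fun _ ↦ 1) continuous_const
    (C := 1) (by simp) ξ

lemma hasFDerivAt_integral_exp_inner (hcpt : IsCompactlySupported μ) (ξ : EucSp n) :
    HasFDerivAt (fun η ↦ ∫ x, Real.exp ⟪η, x⟫ ∂μ)
      (∫ x, Real.exp ⟪ξ, x⟫ • innerSL ℝ x ∂μ) ξ ∧
    Integrable (fun x ↦ Real.exp ⟪ξ, x⟫ • innerSL ℝ x) μ := by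
  simpa using hasFDerivAt_integral_mul_exp_inner hcpt (g := fun _ ↦ 1) continuous_const
    (C := 1) (by simp) ξ

lemma differentiable_logLaplace (hcpt : IsCompactlySupported μ) :
    Differentiable ℝ (logLaplace μ) := fun ξ ↦
  (hasFDerivAt_integral_exp_inner hcpt ξ).1.differentiableAt.log
    (integral_exp_inner_pos hcpt ξ).ne'

lemma fderiv_logLaplace_apply (hcpt : IsCompactlySupported μ) (ξ v : EucSp n) :
    fderiv ℝ (logLaplace μ) ξ v =
      (∫ x, ⟪x, v⟫ * Real.exp ⟪ξ, x⟫ ∂μ) / ∫ x, Real.exp ⟪ξ, x⟫ ∂μ := by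
  obtain ⟨hd, hi⟩ := hasFDerivAt_integral_exp_inner hcpt ξ
  have h : HasFDerivAt (logLaplace μ) _ ξ := hd.log (integral_exp_inner_pos hcpt ξ).ne'
  rw [h.fderiv, _root_.smul_apply, ContinuousLinearMap.integral_apply hi,
    smul_eq_mul, div_eq_inv_mul]
  simp [mul_comm]

lemma differentiable_fderiv_logLaplace_apply (hcpt : IsCompactlySupported μ) (v : EucSp n) :
    Differentiable ℝ fun ξ ↦ fderiv ℝ (logLaplace μ) ξ v := by
  obtain ⟨R, -, hR⟩ := hcpt.exists_ae_norm_le_s15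
  simp_rw [fderiv_logLaplace_apply hcpt, div_eq_mul_inv]
  intro ξ
  have hb : ∀ᵐ x ∂μ, ‖⟪x, v⟫‖ ≤ R * ‖v‖ := by
    filter_upwards [hR] with x hx
    exact (norm_inner_le_norm x v).trans (mul_le_mul_of_nonneg_right hx (norm_nonneg v))
  have hnum := (hasFDerivAt_integral_mul_exp_inner hcpt (by fun_prop) hb ξ).1.differentiableAt
  have hden := (hasFDerivAt_integral_exp_inner hcpt ξ).1.differentiableAt
  exact hnum.mul (hden.inv (integral_exp_inner_pos hcpt ξ).ne')

lemma integrableExpSet_inner (hcpt : IsCompactlySupported μ) (v : EucSp n) :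
    ProbabilityTheory.integrableExpSet (fun x ↦ ⟪v, x⟫) μ = univ := by
  refine eq_univ_of_forall fun t ↦ ?_
  simpa [ProbabilityTheory.integrableExpSet, real_inner_smul_left] using
    integrable_mul_exp_inner hcpt (g := fun _ ↦ 1) continuous_const (C := 1) (by simp) (t • v)

variable (μ)

/-- The Riemannian length of the segment from `0` to `T • v` in the Hessian metric of the
logarithmic Laplace transform is at most `√(Λ (2 T v))`. -/
lemma segment_length_le_sqrt_logLaplace (hcpt : IsCompactlySupported μ)
    (hbar : (∫ x, x ∂μ) = 0) (v : EucSp n) {T : ℝ} (hT : 0 ≤ T) :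
    ∫ t in (0:ℝ)..T, √(dirDeriv2 (logLaplace μ) (t • v) v) ≤ √(logLaplace μ ((2 * T) • v)) := by
  set X : EucSp n → ℝ := fun x ↦ ⟪v, x⟫ with hX
  have hmem (t : ℝ) : t ∈ interior (ProbabilityTheory.integrableExpSet X μ) := by
    simp [hX, integrableExpSet_inner hcpt]
  have hl (t : ℝ) : HasDerivAt (fun t : ℝ ↦ t • v) v t := by
    simpa using (hasDerivAt_id t).smul_const v
  have hf (t : ℝ) : HasDerivAt (fun t : ℝ ↦ logLaplace μ (t • v))
      (fderiv ℝ (logLaplace μ) (t • v) v) t :=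
    (differentiable_logLaplace hcpt (t • v)).hasFDerivAt.comp_hasDerivAt
      (f := fun t : ℝ ↦ t • v) t (hl t)
  have hf' (t : ℝ) : HasDerivAt (fun t : ℝ ↦ fderiv ℝ (logLaplace μ) (t • v) v)
      (dirDeriv2 (logLaplace μ) (t • v) v) t :=
    (differentiable_fderiv_logLaplace_apply hcpt v (t • v)).hasFDerivAt.comp_hasDerivAt
      (f := fun t : ℝ ↦ t • v) t (hl t)
  have hcgf : (fun t : ℝ ↦ logLaplace μ (t • v)) = ProbabilityTheory.cgf X μ :=
    funext fun t ↦ logLaplace_smul t v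
  have hsecond : (fun t : ℝ ↦ dirDeriv2 (logLaplace μ) (t • v) v) =
      iteratedDeriv 2 (ProbabilityTheory.cgf X μ) := by
    rw [← hcgf, iteratedDeriv_succ, iteratedDeriv_one, funext fun t ↦ (hf t).deriv]
    exact funext fun t ↦ (hf' t).deriv.symm
  refine integral_sqrt_second_deriv_le hf hf' ?_ (fun t ↦ ?_) ?_ ?_ hT
  · rw [hsecond]
    have h : ContDiff ℝ 2 (ProbabilityTheory.cgf X μ) := contDiff_iff_contDiffAt.mpr fun t ↦
      (ProbabilityTheory.analyticAt_cgf (hmem t)).contDiffAt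
    exact h.continuous_iteratedDeriv 2 le_rfl
  · rw [congrFun hsecond t, ProbabilityTheory.iteratedDeriv_two_cgf_eq_integral (hmem t)]
    exact div_nonneg (integral_nonneg fun x ↦ by positivity) ProbabilityTheory.mgf_nonneg
  · simp [logLaplace]
  · obtain ⟨R, -, hR⟩ := hcpt.exists_ae_norm_le_s15
    have hint : Integrable (fun x : EucSp n ↦ x) μ :=
      Integrable.of_bound continuous_id.aestronglyMeasurable R hR
    have h : ∫ x, ⟪x, v⟫ ∂μ = 0 := by
      simp_rw [real_inner_comm]
      rw [integral_inner hint, hbar, inner_zero_right]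
    simp [fderiv_logLaplace_apply hcpt, h]

end LaplaceTransform

/-- For a compactly-supported probability measure μ whose support is not contained in a
hyperplane and whose barycenter is the origin, for any ξ ≠ 0, with θ = ξ/|ξ|, the
Riemannian length of the straight segment from 0 to ξ in the Hessian metric of Λ_μ is at
most √(Λ_μ(2ξ)); in particular d(ξ,0) ≤ √(Λ_μ(2ξ)). -/
theorem riemannian_dist_to_origin_bound_logLaplace (n : ℕ) (μ : Measure (EucSp n))
    (hprob : IsProbabilityMeasure μ) (hcpt : IsCompactlySupported μ)
    (hhyp : SuppNotInHyperplane μ) (hbar : (∫ x, x ∂μ) = 0)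
    (ξ : EucSp n) (hne : ξ ≠ 0) (θ : EucSp n) (hθ : θ = ‖ξ‖⁻¹ • ξ) :
    (∫ t in (0:ℝ)..‖ξ‖, Real.sqrt (dirDeriv2 (logLaplace μ) (t • θ) θ)) ≤
        Real.sqrt (logLaplace μ ((2:ℝ) • ξ)) ∧
      riemDist (logLaplace μ) ξ 0 ≤ Real.sqrt (logLaplace μ ((2:ℝ) • ξ)) := by
  have hT : 0 ≤ ‖ξ‖ := norm_nonneg ξ
  constructor
  · have h := segment_length_le_sqrt_logLaplace μ hcpt hbar θ hT
    have hs : (2 * ‖ξ‖) • θ = (2 : ℝ) • ξ := by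
      rw [hθ, smul_smul, mul_assoc, mul_inv_cancel₀ (norm_ne_zero_iff.mpr hne), mul_one]
    rwa [hs] at h
  · have h := segment_length_le_sqrt_logLaplace μ hcpt hbar ξ zero_le_one
    rw [mul_one] at h
    refine le_trans (csInf_le ⟨0, ?_⟩ ⟨fun t : ℝ ↦ t • ξ, by fun_prop, by simp, by simp, ?_⟩) h
    · rintro L ⟨γ, -, -, -, rfl⟩
      exact intervalIntegral.integral_nonneg zero_le_one fun t _ ↦ Real.sqrt_nonneg _
    · have hd : ∀ t : ℝ, deriv (fun t : ℝ ↦ t • ξ) t = ξ := fun t ↦ by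
        simpa using ((hasDerivAt_id t).smul_const ξ).deriv
      simp only [pathRiemLength, hd]
end
end

section
/- Let μ be an even, isotropic, log-concave probability measure on ℝⁿ, let 1 ≤ t ≤ √n, and let K_t = { ξ ∈ ℝⁿ : Λ_μ(2ξ) ≤ t² }, where Λ_μ(ξ) = log ∫ exp(ξ·x) dμ(x) (possibly +∞). Then Vol_n(K_t)^{1/n} ≥ c t/√n, where c > 0 is a universal constant and Vol_n is the Lebesgue measure on ℝⁿ. -/
open MeasureTheory Real Set Filter Topology RealInnerProductSpace Matrix
noncomputable section

/-- A measure is even (centrally-symmetric) if μ(A) = μ(−A) for all measurable A. -/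
def IsEvenMeasure {n : ℕ} (μ : Measure (EucSp n)) : Prop :=
  ∀ A : Set (EucSp n), MeasurableSet A → μ A = μ (-A)

open scoped Pointwise in
/-- One-dimensional Brunn–Minkowski inequality, in weighted form. -/
lemma volume_add_le_of_combo {A B C : Set ℝ} (hA : MeasurableSet A) (hB : MeasurableSet B)
    (hA0 : A.Nonempty) (hB0 : B.Nonempty) {l : ℝ} (hl : l ∈ Set.Ioo (0:ℝ) 1)
    (h : ∀ a ∈ A, ∀ b ∈ B, (1 - l) * a + l * b ∈ C) :
    ENNReal.ofReal (1 - l) * volume A + ENNReal.ofReal l * volume B ≤ volume C := by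
  obtain ⟨hl0, hl1⟩ := hl
  have hl1' : 0 < 1 - l := by linarith
  -- the compact case
  have key : ∀ K ⊆ A, ∀ L ⊆ B, IsCompact K → IsCompact L → K.Nonempty → L.Nonempty →
      ENNReal.ofReal (1 - l) * volume K + ENNReal.ofReal l * volume L ≤ volume C := by
    intro K hKA L hLB hK hL hK0 hL0
    obtain ⟨a, haK, ha⟩ := hK.exists_isGreatest hK0
    obtain ⟨b, hbL, hb⟩ := hL.exists_isLeast hL0
    set z := (1 - l) * a + l * b with hz
    have h1 : (fun x => (1 - l) * x + l * b) '' K ⊆ C ∩ Iic z := by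
      rintro _ ⟨x, hx, rfl⟩
      refine ⟨h _ (hKA hx) _ (hLB hbL), ?_⟩
      have := ha hx
      simp only [mem_Iic, hz]
      gcongr
    have h2 : (fun y => l * y + (1 - l) * a) '' L ⊆ C ∩ Ici z := by
      rintro _ ⟨y, hy, rfl⟩
      refine ⟨by
        change l * y + (1 - l) * a ∈ C
        rw [add_comm]; exact h _ (hKA haK) _ (hLB hy), ?_⟩
      have := hb hy
      simp only [mem_Ici, hz]
      nlinarith
    have himg : ∀ (c d : ℝ) (S : Set ℝ), 0 < c →
        volume ((fun x => c * x + d) '' S) = ENNReal.ofReal c * volume S := by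
      intro c d S hc
      have : (fun x => c * x + d) '' S = (fun x => x + d) '' (c • S) := by
        rw [← image_smul, image_image]; simp
      rw [this, image_add_right, measure_preimage_add_right, Measure.addHaar_smul]
      simp [abs_of_pos hc]
    have h1v := measure_mono (μ := volume) h1
    have h2v := measure_mono (μ := volume) h2
    rw [himg _ _ _ hl1'] at h1v
    rw [himg _ _ _ hl0] at h2v
    have hsplit : volume (C ∩ Iic z) + volume (C ∩ Ici z) ≤ volume C := by
      have e : volume (C ∩ Ici z) = volume (C \ Iic z) := by
        apply measure_congr
        have : C \ Iic z = C ∩ Ioi z := by ext; simp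
        rw [this]
        exact (ae_eq_refl C).inter Ioi_ae_eq_Ici.symm
      rw [e, measure_inter_add_sdiff _ measurableSet_Iic]
    exact (add_le_add h1v h2v).trans hsplit
  obtain ⟨a0, ha0⟩ := hA0
  obtain ⟨b0, hb0⟩ := hB0
  have step : ∀ L ⊆ B, IsCompact L → L.Nonempty →
      ENNReal.ofReal (1 - l) * volume A + ENNReal.ofReal l * volume L ≤ volume C := by
    intro L hL hLc hL0
    rw [hA.measure_eq_iSup_isCompact]
    simp only [ENNReal.mul_iSup]
    rw [ENNReal.iSup_add]
    refine iSup_le fun K => ?_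
    by_cases hKA : K ⊆ A
    · by_cases hK : IsCompact K
      · simp only [hKA, hK, iSup_pos]
        refine le_trans ?_ (key (K ∪ {a0}) (union_subset hKA (by simpa using ha0)) L hL
          (hK.union isCompact_singleton) hLc (by simp) hL0)
        gcongr
        exact subset_union_left
      · simp only [hKA, hK, iSup_pos, iSup_false]
        refine le_trans ?_ (key {a0} (by simpa using ha0) L hL isCompact_singleton hLc
          (by simp) hL0)
        simp
    · simp only [hKA, iSup_false]
      refine le_trans ?_ (key {a0} (by simpa using ha0) L hL isCompact_singleton hLc
          (by simp) hL0)
      simp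
  rw [hB.measure_eq_iSup_isCompact]
  simp only [ENNReal.mul_iSup]
  rw [ENNReal.add_iSup]
  refine iSup_le fun K => ?_
  by_cases hKB : K ⊆ B
  · by_cases hK : IsCompact K
    · simp only [hKB, hK, iSup_pos]
      refine le_trans ?_ (step (K ∪ {b0}) (union_subset hKB (by simpa using hb0))
        (hK.union isCompact_singleton) (by simp))
      gcongr
      exact subset_union_left
    · simp only [hKB, hK, iSup_pos, iSup_false]
      refine le_trans ?_ (step {b0} (by simpa using hb0) isCompact_singleton (by simp))
      simp
  · simp only [hKB, iSup_false]
    refine le_trans ?_ (step {b0} (by simpa using hb0) isCompact_singleton (by simp))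
    simp

/-- Weighted arithmetic-geometric mean inequality for extended nonnegative reals. -/
lemma ennreal_geom_mean_le_arith_mean {l : ℝ} (hl : l ∈ Set.Ioo (0:ℝ) 1) (a b : ENNReal) :
    a ^ (1 - l) * b ^ l ≤ ENNReal.ofReal (1 - l) * a + ENNReal.ofReal l * b := by
  obtain ⟨hl0, hl1⟩ := hl
  have hl1' : 0 < 1 - l := by linarith
  rcases eq_or_ne a ⊤ with rfl | ha
  · rw [ENNReal.mul_top (by simpa using hl1)]; simp
  rcases eq_or_ne b ⊤ with rfl | hb
  · rw [ENNReal.mul_top (by simpa using hl0)]; simp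
  lift a to NNReal using ha
  lift b to NNReal using hb
  have := NNReal.geom_mean_le_arith_mean2_weighted (1 - l).toNNReal l.toNNReal a b (by
    rw [← Real.toNNReal_add hl1'.le hl0.le]; simp)
  rw [Real.coe_toNNReal _ hl1'.le, Real.coe_toNNReal _ hl0.le] at this
  rw [← ENNReal.coe_rpow_of_nonneg _ hl1'.le, ← ENNReal.coe_rpow_of_nonneg _ hl0.le]
  simp only [ENNReal.ofReal]
  exact_mod_cast this

/-- Prékopa–Leindler on the line for functions with supremum one. -/
lemma prekopaLeindler_real_normalized {f g h : ℝ → ℝ} (hf : Measurable f) (hg : Measurable g)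
    (hh : Measurable h) (hf0 : ∀ x, 0 ≤ f x) (hg0 : ∀ x, 0 ≤ g x) (hh0 : ∀ x, 0 ≤ h x)
    (hf1 : ∀ x, f x ≤ 1) (hg1 : ∀ x, g x ≤ 1)
    (hfs : ∀ t < 1, ∃ x, t < f x) (hgs : ∀ t < 1, ∃ x, t < g x)
    {l : ℝ} (hl : l ∈ Set.Ioo (0:ℝ) 1)
    (H : ∀ x y, f x ^ (1 - l) * g y ^ l ≤ h ((1 - l) * x + l * y)) :
    ENNReal.ofReal (1 - l) * (∫⁻ x, ENNReal.ofReal (f x)) +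
      ENNReal.ofReal l * (∫⁻ x, ENNReal.ofReal (g x)) ≤ ∫⁻ x, ENNReal.ofReal (h x) := by
  have hl' := hl
  obtain ⟨hl0, hl1⟩ := hl'
  have hl1' : 0 < 1 - l := by linarith
  rw [lintegral_eq_lintegral_meas_lt _ (ae_of_all _ hf0) hf.aemeasurable,
    lintegral_eq_lintegral_meas_lt _ (ae_of_all _ hg0) hg.aemeasurable,
    lintegral_eq_lintegral_meas_lt _ (ae_of_all _ hh0) hh.aemeasurable]
  have hm : ∀ f : ℝ → ℝ, Measurable fun t => volume {a | t < f a} := by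
    intro f
    apply Antitone.measurable
    intro s t hst
    exact measure_mono fun x hx => lt_of_le_of_lt hst hx
  rw [← lintegral_const_mul _ (hm f), ← lintegral_const_mul _ (hm g),
    ← lintegral_add_left ((hm f).const_mul _)]
  refine setLIntegral_mono (hm h) fun t ht => ?_
  rw [mem_Ioi] at ht
  rcases lt_or_ge t 1 with ht1 | ht1
  · refine volume_add_le_of_combo (measurableSet_lt measurable_const hf)
      (measurableSet_lt measurable_const hg) (hfs t ht1) (hgs t ht1) hl ?_
    intro a ha b hb
    simp only [mem_ofPred_eq] at ha hb ⊢
    refine lt_of_lt_of_le ?_ (H a b)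
    calc t = t ^ (1 - l) * t ^ l := by
            rw [← Real.rpow_add ht]; simp
      _ < f a ^ (1 - l) * g b ^ l := by
            have h1 := Real.rpow_lt_rpow ht.le ha hl1'
            have h2 := Real.rpow_lt_rpow ht.le hb hl0
            exact mul_lt_mul'' h1 h2 (by positivity) (by positivity)
  · have e1 : {a | t < f a} = ∅ := by
      ext x; simpa using (hf1 x).trans ht1
    have e2 : {a | t < g a} = ∅ := by
      ext x; simpa using (hg1 x).trans ht1
    simp [e1, e2]

/-- The Prékopa–Leindler inequality holds on the measure space `E`. -/
def PrekopaLeindler (E : Type*) [AddCommGroup E] [Module ℝ E] [MeasureSpace E] : Prop :=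
  ∀ (l : ℝ), l ∈ Set.Ioo (0:ℝ) 1 → ∀ f g h : E → ENNReal, Measurable f → Measurable g →
    Measurable h → (∀ x y, f x ^ (1 - l) * g y ^ l ≤ h ((1 - l) • x + l • y)) →
    (∫⁻ x, f x) ^ (1 - l) * (∫⁻ x, g x) ^ l ≤ ∫⁻ x, h x

lemma prekopaLeindler_real_bounded {l : ℝ} (hl : l ∈ Set.Ioo (0:ℝ) 1) {f g h : ℝ → ENNReal}
    (hf : Measurable f) (hg : Measurable g) (hh : Measurable h)
    (hfb : ⨆ x, f x ≠ ⊤) (hgb : ⨆ x, g x ≠ ⊤)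
    (H : ∀ x y, f x ^ (1 - l) * g y ^ l ≤ h ((1 - l) • x + l • y)) :
    (∫⁻ x, f x) ^ (1 - l) * (∫⁻ x, g x) ^ l ≤ ∫⁻ x, h x := by
  have hl' := hl
  obtain ⟨hl0, hl1⟩ := hl'
  have hl1' : 0 < 1 - l := by linarith
  set F := ⨆ x, f x with hF
  set G := ⨆ x, g x with hG
  have hfF : ∀ x, f x ≤ F := le_iSup f
  have hgG : ∀ x, g x ≤ G := le_iSup g
  by_cases hF0 : F = 0
  · have : ∀ x, f x = 0 := fun x => le_antisymm (hF0 ▸ hfF x) bot_le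
    simp [this, hl1]
  by_cases hG0 : G = 0
  · have : ∀ x, g x = 0 := fun x => le_antisymm (hG0 ▸ hgG x) bot_le
    simp [this, hl0]
  set M := F ^ (1 - l) * G ^ l with hM
  have hM0 : M ≠ 0 := mul_ne_zero (by simp [ENNReal.rpow_eq_zero_iff, hF0, hfb])
    (by simp [ENNReal.rpow_eq_zero_iff, hG0, hgb])
  have hMt : M ≠ ⊤ := ENNReal.mul_ne_top (ENNReal.rpow_ne_top_of_nonneg hl1'.le hfb)
    (ENNReal.rpow_ne_top_of_nonneg hl0.le hgb)
  have hdt : ∀ {a b : ENNReal}, b ≠ 0 → b ≠ ⊤ → a ≤ b → a / b ≠ ⊤ := by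
    intro a b h0 ht hab
    exact (ENNReal.div_lt_top (ne_top_of_le_ne_top ht hab) h0).ne
  have hd1 : ∀ {a b : ENNReal}, b ≠ 0 → b ≠ ⊤ → a ≤ b → (a / b).toReal ≤ 1 := by
    intro a b h0 ht hab
    refine ENNReal.toReal_le_of_le_ofReal zero_le_one ?_
    simpa using ENNReal.div_le_of_le_mul (by simpa using hab)
  have hsup : ∀ (f : ℝ → ENNReal), (⨆ x, f x) ≠ 0 → (⨆ x, f x) ≠ ⊤ →
      ∀ t < (1:ℝ), ∃ x, t < (f x / ⨆ x, f x).toReal := by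
    intro f h0 ht t ht1
    rcases lt_or_ge t 0 with ht0 | ht0
    · exact ⟨0, ht0.trans_le ENNReal.toReal_nonneg⟩
    have : ENNReal.ofReal t * (⨆ x, f x) < ⨆ x, f x := by
      calc ENNReal.ofReal t * (⨆ x, f x) < 1 * ⨆ x, f x := by
            rw [ENNReal.mul_lt_mul_iff_left h0 ht]
            simpa using ht1
        _ = _ := one_mul _
    obtain ⟨x, hx⟩ := lt_iSup_iff.1 this
    refine ⟨x, ?_⟩
    rw [← ENNReal.ofReal_lt_iff_lt_toReal ht0 (hdt h0 ht (le_iSup f x)),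
      ENNReal.lt_div_iff_mul_lt (Or.inl h0) (Or.inl ht)]
    exact hx
  have main := prekopaLeindler_real_normalized
    (f := fun x => (f x / F).toReal) (g := fun x => (g x / G).toReal)
    (h := fun x => (min (h x) M / M).toReal) (hf.div_const _).ennreal_toReal
    (hg.div_const _).ennreal_toReal ((hh.min measurable_const).div_const _).ennreal_toReal
    (fun _ => ENNReal.toReal_nonneg) (fun _ => ENNReal.toReal_nonneg)
    (fun _ => ENNReal.toReal_nonneg) (fun x => hd1 hF0 hfb (hfF x)) (fun x => hd1 hG0 hgb (hgG x))
    (hsup f hF0 hfb) (hsup g hG0 hgb) hl (by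
      intro x y
      rw [ENNReal.toReal_rpow, ENNReal.toReal_rpow, ← ENNReal.toReal_mul]
      refine ENNReal.toReal_mono (hdt hM0 hMt (min_le_right _ _)) ?_
      rw [ENNReal.div_rpow_of_nonneg _ _ hl1'.le, ENNReal.div_rpow_of_nonneg _ _ hl0.le]
      have : f x ^ (1 - l) / F ^ (1 - l) * (g y ^ l / G ^ l) =
          (f x ^ (1 - l) * g y ^ l) / M := by
        rw [hM, div_eq_mul_inv, div_eq_mul_inv, div_eq_mul_inv, ENNReal.mul_inv]
        · ring
        · right; exact ENNReal.rpow_ne_top_of_nonneg hl0.le hgb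
        · right; simp [ENNReal.rpow_eq_zero_iff, hG0, hgb]
      rw [this]
      gcongr
      refine le_min (H x y) ?_
      rw [hM]
      gcongr
      · exact hfF x
      · exact hgG y)
  have eq1 : ∀ (f : ℝ → ENNReal) (F : ENNReal), F ≠ 0 → F ≠ ⊤ → (∀ x, f x ≤ F) → Measurable f →
      ∫⁻ x, ENNReal.ofReal ((f x / F).toReal) = (∫⁻ x, f x) / F := by
    intro f F h0 ht hle hm
    rw [div_eq_mul_inv, ← lintegral_mul_const _ hm]
    refine lintegral_congr fun x => ?_
    rw [ENNReal.ofReal_toReal (hdt h0 ht (hle x)), div_eq_mul_inv]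
  rw [eq1 f F hF0 hfb hfF hf, eq1 g G hG0 hgb hgG hg,
    eq1 _ M hM0 hMt (fun x => min_le_right _ _) (hh.min measurable_const)] at main
  have main2 := (ennreal_geom_mean_le_arith_mean hl _ _).trans main
  rw [ENNReal.div_rpow_of_nonneg _ _ hl1'.le, ENNReal.div_rpow_of_nonneg _ _ hl0.le] at main2
  have e : ∀ a b : ENNReal, a / F ^ (1 - l) * (b / G ^ l) = a * b / M := by
    intro a b
    rw [hM, div_eq_mul_inv, div_eq_mul_inv, div_eq_mul_inv, ENNReal.mul_inv]
    · ring
    · right; exact ENNReal.rpow_ne_top_of_nonneg hl0.le hgb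
    · right; simp [ENNReal.rpow_eq_zero_iff, hG0, hgb]
  rw [e, ENNReal.div_le_iff hM0 hMt, ENNReal.div_mul_cancel hM0 hMt] at main2
  exact main2.trans (lintegral_mono fun x => min_le_left _ _)

lemma prekopaLeindler_real : PrekopaLeindler ℝ := by
  intro l hl f g h hf hg hh H
  obtain ⟨hl0, hl1⟩ := hl
  have hl1' : 0 < 1 - l := by linarith
  have trunc : ∀ f : ℝ → ENNReal, Measurable f →
      ∫⁻ x, f x = ⨆ n : ℕ, ∫⁻ x, min (f x) n := by
    intro f hf
    rw [← lintegral_iSup (fun n => hf.min measurable_const)]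
    · refine lintegral_congr fun x => ?_
      apply le_antisymm _ (iSup_le fun n => min_le_left _ _)
      rw [← inf_iSup_eq, ENNReal.iSup_natCast]
      simp
    · intro m n hmn x
      exact min_le_min le_rfl (by exact_mod_cast hmn)
  have mono : ∀ f : ℝ → ENNReal, Monotone fun n : ℕ => ∫⁻ x, min (f x) n := by
    intro f m n hmn
    exact lintegral_mono fun x => min_le_min le_rfl (by exact_mod_cast hmn)
  have hb : ∀ (f : ℝ → ENNReal) (n : ℕ), ⨆ x, min (f x) n ≠ ⊤ := fun f n =>
    ne_top_of_le_ne_top (ENNReal.natCast_ne_top n) (iSup_le fun x => min_le_right _ _)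
  have tf := (tendsto_atTop_iSup (mono f)).ennrpow_const (1 - l)
  have tg := (tendsto_atTop_iSup (mono g)).ennrpow_const l
  rw [← trunc f hf] at tf
  rw [← trunc g hg] at tg
  have bd : ∀ n : ℕ, (∫⁻ x, min (f x) n) ^ (1 - l) * (∫⁻ x, min (g x) n) ^ l ≤ ∫⁻ x, h x := by
    intro n
    refine prekopaLeindler_real_bounded ⟨hl0, hl1⟩ (hf.min measurable_const)
      (hg.min measurable_const) hh (hb f n) (hb g n) fun x y => le_trans ?_ (H x y)
    gcongr
    · exact min_le_left _ _
    · exact min_le_left _ _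
  by_cases h0 : ∫⁻ x, f x = 0
  · simp [h0, hl1]
  by_cases h0' : ∫⁻ x, g x = 0
  · simp [h0', hl0]
  refine le_of_tendsto' (ENNReal.Tendsto.mul tf ?_ tg ?_) bd
  · left; simp [ENNReal.rpow_eq_zero_iff, h0, hl1'.not_gt]
  · left; simp [ENNReal.rpow_eq_zero_iff, h0', hl0.not_gt]

lemma PrekopaLeindler.prod {E F : Type*} [AddCommGroup E] [Module ℝ E] [MeasureSpace E]
    [AddCommGroup F] [Module ℝ F] [MeasureSpace F] [SFinite (volume : Measure E)]
    [SFinite (volume : Measure F)]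
    (hE : PrekopaLeindler E) (hF : PrekopaLeindler F) : PrekopaLeindler (E × F) := by
  intro l hl f g h hf hg hh H
  rw [Measure.volume_eq_prod, lintegral_prod _ hf.aemeasurable, lintegral_prod _ hg.aemeasurable,
    lintegral_prod _ hh.aemeasurable]
  refine hE l hl _ _ _ hf.lintegral_prod_right' hg.lintegral_prod_right' hh.lintegral_prod_right' ?_
  intro x y
  refine hF l hl _ _ _ (hf.comp measurable_prodMk_left) (hg.comp measurable_prodMk_left)
    (hh.comp measurable_prodMk_left) ?_
  intro u v
  exact H (x, u) (y, v)

lemma PrekopaLeindler.of_measurePreserving {E F : Type*} [AddCommGroup E] [Module ℝ E]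
    [MeasureSpace E] [AddCommGroup F] [Module ℝ F] [MeasureSpace F]
    (hE : PrekopaLeindler E) (e : E →ₗ[ℝ] F) (he : MeasurePreserving e) : PrekopaLeindler F := by
  intro l hl f g h hf hg hh H
  rw [← he.lintegral_comp hf, ← he.lintegral_comp hg, ← he.lintegral_comp hh]
  refine hE l hl _ _ _ (hf.comp he.measurable) (hg.comp he.measurable) (hh.comp he.measurable) ?_
  intro x y
  simpa using H (e x) (e y)

lemma prekopaLeindler_pi (n : ℕ) : PrekopaLeindler (Fin n → ℝ) := by
  induction n with
  | zero =>
    intro l hl f g h hf hg hh H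
    have : ∀ f : (Fin 0 → ℝ) → ENNReal, ∫⁻ x, f x = f 0 := by
      intro f
      rw [volume_pi, Measure.pi_of_empty _ (0 : Fin 0 → ℝ), lintegral_dirac]
    rw [this, this, this]
    simpa using H 0 0
  | succ n ih =>
    refine (prekopaLeindler_real.prod ih).of_measurePreserving
      { toFun := fun p => Fin.cons p.1 p.2
        map_add' := ?_
        map_smul' := ?_ } ?_
    · intro x y
      funext i
      refine Fin.cases ?_ (fun j => ?_) i <;> simp
    · intro c x
      funext i
      refine Fin.cases ?_ (fun j => ?_) i <;> simp
    · have := (volume_preserving_piFinSuccAbove (fun _ : Fin (n + 1) => ℝ) 0).symm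
      have e : (fun p : ℝ × (Fin n → ℝ) => (Fin.cons p.1 p.2 : Fin (n + 1) → ℝ)) =
          ⇑(MeasurableEquiv.piFinSuccAbove (fun _ : Fin (n + 1) => ℝ) 0).symm := by
        funext p
        simp [MeasurableEquiv.piFinSuccAbove, Fin.insertNthEquiv]
      rw [← e] at this
      exact this

lemma prekopaLeindler_eucSp (n : ℕ) : PrekopaLeindler (EucSp n) :=
  (prekopaLeindler_pi n).of_measurePreserving
    (WithLp.linearEquiv 2 ℝ (Fin n → ℝ)).symm.toLinearMap (PiLp.volume_preserving_toLp (Fin n))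

/-- Log-concavity of a measure in terms of Minkowski combinations of sets. -/
def IsLogConcaveMeasure {E : Type*} [AddCommGroup E] [Module ℝ E] [MeasurableSpace E]
    (μ : Measure E) : Prop :=
  ∀ l : ℝ, l ∈ Set.Ioo (0:ℝ) 1 → ∀ A B C : Set E, MeasurableSet A → MeasurableSet B →
    MeasurableSet C → (∀ a ∈ A, ∀ b ∈ B, (1 - l) • a + l • b ∈ C) →
    μ A ^ (1 - l) * μ B ^ l ≤ μ C

lemma IsLogConcaveMeasure.map {E F : Type*} [AddCommGroup E] [Module ℝ E] [MeasurableSpace E]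
    [AddCommGroup F] [Module ℝ F] [MeasurableSpace F] {μ : Measure E}
    (hμ : IsLogConcaveMeasure μ) (T : E →ₗ[ℝ] F) (hT : Measurable T) :
    IsLogConcaveMeasure (μ.map T) := by
  intro l hl A B C hA hB hC H
  rw [Measure.map_apply hT hA, Measure.map_apply hT hB, Measure.map_apply hT hC]
  refine hμ l hl _ _ _ (hT hA) (hT hB) (hT hC) fun a ha b hb => ?_
  simpa using H _ ha _ hb

lemma IsLogConcaveFn.convex_support {n : ℕ} {f : EucSp n → ℝ} (hf : IsLogConcaveFn f) :
    Convex ℝ {x | 0 < f x} := by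
  intro x hx y hy a b ha hb hab
  have h := hf.2 x y b ⟨hb, by linarith⟩
  have ha' : 1 - b = a := by linarith
  rw [ha'] at h
  exact lt_of_lt_of_le (mul_pos (Real.rpow_pos_of_pos hx _) (Real.rpow_pos_of_pos hy _)) h

lemma IsLogConcaveFn.continuousOn_interior_support {n : ℕ} {f : EucSp n → ℝ}
    (hf : IsLogConcaveFn f) : ContinuousOn f (interior {x | 0 < f x}) := by
  have hc : ConcaveOn ℝ (interior {x | 0 < f x}) (fun x => Real.log (f x)) := by
    refine ⟨hf.convex_support.interior, ?_⟩
    intro x hx y hy a b ha hb hab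
    have hx' : 0 < f x := (interior_subset hx : x ∈ {z | 0 < f z})
    have hy' : 0 < f y := (interior_subset hy : y ∈ {z | 0 < f z})
    have h := hf.2 x y b ⟨hb, by linarith⟩
    have ha' : 1 - b = a := by linarith
    rw [ha'] at h
    have h2 := Real.log_le_log
      (mul_pos (Real.rpow_pos_of_pos hx' _) (Real.rpow_pos_of_pos hy' _)) h
    rw [Real.log_mul (Real.rpow_pos_of_pos hx' _).ne' (Real.rpow_pos_of_pos hy' _).ne',
      Real.log_rpow hx', Real.log_rpow hy'] at h2
    simpa using h2
  have h1 := (hc.continuousOn isOpen_interior).rexp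
  refine h1.congr fun x hx => ?_
  have hx' : 0 < f x := (interior_subset hx : x ∈ {z | 0 < f z})
  simp [Real.exp_log hx']

/-- A log-concave density agrees almost everywhere with a measurable log-concave density. -/
lemma IsLogConcaveFn.exists_measurable {n : ℕ} {f : EucSp n → ℝ} (hf : IsLogConcaveFn f) :
    ∃ g : EucSp n → ENNReal, Measurable g ∧ (fun x => ENNReal.ofReal (f x)) =ᵐ[volume] g ∧
      ∀ l ∈ Set.Ioo (0:ℝ) 1, ∀ x y, g x ^ (1 - l) * g y ^ l ≤ g ((1 - l) • x + l • y) := by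
  classical
  set U := interior {x | 0 < f x} with hU
  have hUo : IsOpen U := isOpen_interior
  refine ⟨U.indicator fun x => ENNReal.ofReal (f x), ?_, ?_, ?_⟩
  · have : Measurable (U.piecewise f 0) := by
      apply ContinuousOn.measurable_piecewise hf.continuousOn_interior_support
      · exact continuousOn_const
      · exact hUo.measurableSet
    have h2 := this.ennreal_ofReal
    convert h2 using 2 with x
    by_cases hx : x ∈ U <;> simp [hx]
  · have h0 : ∀ᵐ x ∂(volume : Measure (EucSp n)), x ∉ frontier {x | 0 < f x} := by
      rw [← measure_eq_zero_iff_ae_notMem]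
      exact hf.convex_support.addHaar_frontier _
    filter_upwards [h0] with x hx
    by_cases hxU : x ∈ U
    · simp [hxU]
    · have : x ∉ closure {x | 0 < f x} := fun h => hx ⟨h, hxU⟩
      have h2 : ¬ 0 < f x := fun h => this (subset_closure h)
      have h3 : f x = 0 := le_antisymm (not_lt.1 h2) (hf.1 x)
      simp [hxU, h3]
  · intro l hl x y
    obtain ⟨hl0, hl1⟩ := hl
    have hl1' : 0 < 1 - l := by linarith
    by_cases hx : x ∈ U
    · by_cases hy : y ∈ U
      · have hz : (1 - l) • x + l • y ∈ U :=
          hf.convex_support.interior hx hy hl1'.le hl0.le (by ring)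
        simp only [hx, hy, hz, indicator_of_mem]
        rw [ENNReal.ofReal_rpow_of_nonneg (hf.1 x) hl1'.le,
          ENNReal.ofReal_rpow_of_nonneg (hf.1 y) hl0.le,
          ← ENNReal.ofReal_mul (Real.rpow_nonneg (hf.1 x) _)]
        exact ENNReal.ofReal_le_ofReal (hf.2 x y l ⟨hl0.le, hl1.le⟩)
      · simp [hy, hl0]
    · simp [hx, hl1]

lemma IsLogConcave.isLogConcaveMeasure {n : ℕ} {μ : Measure (EucSp n)} (hμ : IsLogConcave μ) :
    IsLogConcaveMeasure μ := by
  obtain ⟨f, hf, rfl⟩ := hμ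
  obtain ⟨g, hg, hfg, hgl⟩ := hf.exists_measurable
  rw [withDensity_congr_ae hfg]
  intro l hl A B C hA hB hC H
  rw [withDensity_apply _ hA, withDensity_apply _ hB, withDensity_apply _ hC,
    ← lintegral_indicator hA, ← lintegral_indicator hB, ← lintegral_indicator hC]
  refine prekopaLeindler_eucSp n l hl _ _ _ (hg.indicator hA) (hg.indicator hB)
    (hg.indicator hC) fun x y => ?_
  by_cases hx : x ∈ A
  · by_cases hy : y ∈ B
    · simpa [hx, hy, H x hx y hy] using hgl l hl x y
    · simp [hy, hl.1]
  · simp [hx, hl.2]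

section Gaussian

set_option linter.unusedSectionVars false

variable (E : Type*) [NormedAddCommGroup E] [InnerProductSpace ℝ E] [FiniteDimensional ℝ E]
  [MeasurableSpace E] [BorelSpace E]

/-- The density of the standard Gaussian measure. -/
def gaussDensity (x : E) : ℝ :=
  (2 * π) ^ (-(Module.finrank ℝ E / 2 : ℝ)) * Real.exp (-‖x‖ ^ 2 / 2)

/-- The standard Gaussian measure, defined through its density. -/
def gaussMeasure : Measure E :=
  volume.withDensity fun x => ENNReal.ofReal (gaussDensity E x)

variable {E}

lemma measurable_gaussDensity :
    Measurable fun x : E => ENNReal.ofReal (gaussDensity E x) := by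
  unfold gaussDensity; fun_prop

lemma gaussDensity_nonneg (x : E) : 0 ≤ gaussDensity E x := by
  unfold gaussDensity; positivity

lemma gaussDensity_neg (x : E) : gaussDensity E (-x) = gaussDensity E x := by
  simp [gaussDensity]

lemma lintegral_gaussMeasure {f : E → ENNReal} (hf : Measurable f) :
    ∫⁻ x, f x ∂gaussMeasure E = ∫⁻ x, ENNReal.ofReal (gaussDensity E x) * f x := by
  unfold gaussMeasure
  rw [lintegral_withDensity_eq_lintegral_mul _ measurable_gaussDensity hf]
  rfl

lemma gaussMeasure_apply {s : Set E} (hs : MeasurableSet s) :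
    gaussMeasure E s = ∫⁻ x, ENNReal.ofReal (gaussDensity E x) * s.indicator 1 x := by
  rw [← lintegral_gaussMeasure (measurable_one.indicator hs), lintegral_indicator_one hs]

lemma lintegral_exp_neg_mul_sq_norm {b : ℝ} (hb : 0 < b) :
    ∫⁻ x : E, ENNReal.ofReal (Real.exp (-b * ‖x‖ ^ 2)) =
      ENNReal.ofReal ((π / b) ^ (Module.finrank ℝ E / 2 : ℝ)) := by
  rw [← GaussianFourier.integral_rexp_neg_mul_sq_norm hb,
    ofReal_integral_eq_lintegral_ofReal]
  · have h := (GaussianFourier.integrable_cexp_neg_mul_sq_norm_add (V := E) (b := (b : ℂ))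
      (by simpa using hb) 0 0).norm
    refine h.congr (ae_of_all _ fun x => ?_)
    simp only [Complex.norm_exp]
    norm_num
    left; norm_cast
  · exact ae_of_all _ fun x => (Real.exp_pos _).le

lemma lintegral_gaussMeasure_exp_mul_sq_norm {a : ℝ} (ha : a < 1 / 2) :
    ∫⁻ x : E, ENNReal.ofReal (Real.exp (a * ‖x‖ ^ 2)) ∂gaussMeasure E =
      ENNReal.ofReal ((1 - 2 * a) ^ (-(Module.finrank ℝ E / 2 : ℝ))) := by
  have h1 : 0 < 1 - 2 * a := by linarith
  rw [lintegral_gaussMeasure (by fun_prop)]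
  have : ∀ x : E, ENNReal.ofReal (gaussDensity E x) *
      ENNReal.ofReal (Real.exp (a * ‖x‖ ^ 2)) =
      ENNReal.ofReal ((2 * π) ^ (-(Module.finrank ℝ E / 2 : ℝ))) *
        ENNReal.ofReal (Real.exp (-(1 / 2 - a) * ‖x‖ ^ 2)) := by
    intro x
    rw [gaussDensity, ENNReal.ofReal_mul (by positivity), mul_assoc,
      ← ENNReal.ofReal_mul (by positivity), ← Real.exp_add]
    ring_nf
  simp_rw [this]
  rw [lintegral_const_mul _ (by fun_prop), lintegral_exp_neg_mul_sq_norm (by linarith),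
    ← ENNReal.ofReal_mul (by positivity)]
  congr 1
  have h3 : π / (1 / 2 - a) = (2 * π) * (1 - 2 * a)⁻¹ := by
    have : (1 / 2 - a) ≠ 0 := by linarith
    field_simp
  rw [h3, Real.mul_rpow (x := 2 * π) (by positivity) (by positivity), ← mul_assoc,
    ← Real.rpow_add (by positivity), Real.rpow_neg h1.le, Real.inv_rpow h1.le]
  simp

instance : IsProbabilityMeasure (gaussMeasure E) := by
  constructor
  have := lintegral_gaussMeasure_exp_mul_sq_norm (E := E) (a := 0) (by norm_num)
  simpa using this

lemma gaussMeasure_le_volume (s : Set E) :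
    gaussMeasure E s ≤
      ENNReal.ofReal ((2 * π) ^ (-(Module.finrank ℝ E / 2 : ℝ))) * volume s := by
  have h : gaussMeasure E ≤
      ENNReal.ofReal ((2 * π) ^ (-(Module.finrank ℝ E / 2 : ℝ))) • volume := by
    rw [gaussMeasure, ← withDensity_const]
    refine withDensity_mono (ae_of_all _ fun x => ENNReal.ofReal_le_ofReal ?_)
    unfold gaussDensity
    refine mul_le_of_le_one_right (by positivity) (Real.exp_le_one_iff.2 ?_)
    have := sq_nonneg ‖x‖
    linarith
  exact h s

lemma lintegral_gaussMeasure_exp_inner (t : E) :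
    ∫⁻ x : E, ENNReal.ofReal (Real.exp ⟪x, t⟫) ∂gaussMeasure E =
      ENNReal.ofReal (Real.exp (‖t‖ ^ 2 / 2)) := by
  rw [lintegral_gaussMeasure (by fun_prop)]
  have : ∀ x : E, ENNReal.ofReal (gaussDensity E x) * ENNReal.ofReal (Real.exp ⟪x, t⟫) =
      ENNReal.ofReal (Real.exp (‖t‖ ^ 2 / 2)) * ENNReal.ofReal (gaussDensity E (x - t)) := by
    intro x
    rw [← ENNReal.ofReal_mul (gaussDensity_nonneg _), ← ENNReal.ofReal_mul (by positivity),
      gaussDensity, gaussDensity, mul_assoc, ← Real.exp_add, mul_left_comm, ← Real.exp_add,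
      norm_sub_sq_real]
    ring_nf
  simp_rw [this]
  have m : Measurable fun x : E => ENNReal.ofReal (gaussDensity E (x - t)) :=
    measurable_gaussDensity.comp (measurable_sub_const t)
  rw [lintegral_const_mul _ m,
    lintegral_sub_right_eq_self (fun x => ENNReal.ofReal (gaussDensity E x)) t]
  have h := measure_univ (μ := gaussMeasure E)
  rw [gaussMeasure_apply MeasurableSet.univ] at h
  simp at h
  simp [h]

lemma gaussMeasure_inner_gt_le (t : E) {b : ℝ} (hb : 0 ≤ b) {r : ℝ} (hr : ‖t‖ ≤ r) (hr0 : 0 < r) :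
    gaussMeasure E {x | b * r < ⟪x, t⟫} ≤ ENNReal.ofReal (Real.exp (-b ^ 2 / 2)) := by
  have h1 := mul_meas_ge_le_lintegral (μ := gaussMeasure E)
    (f := fun x => ENNReal.ofReal (Real.exp ⟪x, (b / r) • t⟫)) (by fun_prop)
    (ENNReal.ofReal (Real.exp (b ^ 2)))
  rw [lintegral_gaussMeasure_exp_inner] at h1
  have h2 : ‖(b / r) • t‖ ≤ b := by
    rw [norm_smul, Real.norm_of_nonneg (by positivity)]
    calc b / r * ‖t‖ ≤ b / r * r := by gcongr
      _ = b := by field_simp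
  have h3 : gaussMeasure E {x | b * r < ⟪x, t⟫} ≤ gaussMeasure E
      {x | ENNReal.ofReal (Real.exp (b ^ 2)) ≤
        ENNReal.ofReal (Real.exp ⟪x, (b / r) • t⟫)} := by
    refine measure_mono fun x hx => ?_
    have hx' : b * r < ⟪x, t⟫ := hx
    refine ENNReal.ofReal_le_ofReal (Real.exp_le_exp.2 ?_)
    rw [inner_smul_right]
    calc b ^ 2 = b / r * (b * r) := by field_simp
      _ ≤ b / r * ⟪x, t⟫ := by gcongr
  have h4 : ENNReal.ofReal (Real.exp (b ^ 2)) ≠ 0 := by simp [Real.exp_pos]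
  refine h3.trans ?_
  rw [← ENNReal.mul_le_mul_iff_right h4 ENNReal.ofReal_ne_top]
  refine h1.trans ?_
  rw [← ENNReal.ofReal_mul (by positivity), ← Real.exp_add]
  refine ENNReal.ofReal_le_ofReal (Real.exp_le_exp.2 ?_)
  have := pow_le_pow_left₀ (norm_nonneg _) h2 2
  linarith

lemma gaussMeasure_norm_gt_le (hE : 1 ≤ Module.finrank ℝ E) :
    gaussMeasure E {x | 4 * √(Module.finrank ℝ E) < ‖x‖} ≤ ENNReal.ofReal (1 / 20) := by
  set d := Module.finrank ℝ E with hd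
  have h1 := mul_meas_ge_le_lintegral (μ := gaussMeasure E)
    (f := fun x => ENNReal.ofReal (Real.exp (1 / 4 * ‖x‖ ^ 2))) (by fun_prop)
    (ENNReal.ofReal (Real.exp (4 * d)))
  rw [lintegral_gaussMeasure_exp_mul_sq_norm (by norm_num)] at h1
  have h3 : gaussMeasure E {x | 4 * √d < ‖x‖} ≤ gaussMeasure E
      {x | ENNReal.ofReal (Real.exp (4 * d)) ≤
        ENNReal.ofReal (Real.exp (1 / 4 * ‖x‖ ^ 2))} := by
    refine measure_mono fun x hx => ?_
    have hx' : 4 * √d < ‖x‖ := hx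
    refine ENNReal.ofReal_le_ofReal (Real.exp_le_exp.2 ?_)
    have := pow_le_pow_left₀ (by positivity) hx'.le 2
    rw [mul_pow, Real.sq_sqrt (by positivity)] at this
    linarith
  have h4 : ENNReal.ofReal (Real.exp (4 * d)) ≠ 0 := by simp [Real.exp_pos]
  refine h3.trans ?_
  rw [← ENNReal.mul_le_mul_iff_right h4 ENNReal.ofReal_ne_top]
  refine h1.trans ?_
  rw [← ENNReal.ofReal_mul (by positivity)]
  refine ENNReal.ofReal_le_ofReal ?_
  have h5 : ((1 : ℝ) - 2 * (1 / 4)) ^ (-(d / 2 : ℝ)) ≤ 2 ^ (d : ℝ) := by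
    rw [show ((1 : ℝ) - 2 * (1 / 4)) = 2⁻¹ by norm_num, Real.inv_rpow (by norm_num),
      Real.rpow_neg (by norm_num), inv_inv]
    refine Real.rpow_le_rpow_of_exponent_le (by norm_num) ?_
    have : (0:ℝ) ≤ d := by positivity
    linarith
  refine h5.trans ?_
  have h6 : (40 : ℝ) ≤ Real.exp 4 := by
    have := Real.exp_one_gt_d9
    have h7 : Real.exp 4 = Real.exp 1 ^ 4 := by rw [← Real.exp_nat_mul]; norm_num
    rw [h7]
    have : (2.7 : ℝ) ^ 4 ≤ Real.exp 1 ^ 4 := by gcongr; linarith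
    norm_num at this ⊢
    linarith
  rw [mul_comm (4:ℝ), mul_comm, Real.rpow_natCast, ← mul_comm (4:ℝ)]
  have h8 : Real.exp (4 * d) = Real.exp 4 ^ d := by rw [← Real.exp_nat_mul]; ring_nf
  rw [h8]
  have h9 : (20 : ℝ) * 2 ^ d ≤ 40 ^ d := by
    have : (40 : ℝ) ^ d = 20 ^ d * 2 ^ d := by rw [← mul_pow]; norm_num
    rw [this]
    gcongr
    exact le_self_pow₀ (by norm_num) (by omega)
  have h10 : (40 : ℝ) ^ d ≤ Real.exp 4 ^ d := by gcongr
  linarith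

lemma gaussMeasure_closedBall_ge (hE : 1 ≤ Module.finrank ℝ E) :
    ENNReal.ofReal (19 / 20) ≤
      gaussMeasure E (Metric.closedBall 0 (4 * √(Module.finrank ℝ E))) := by
  have h := prob_compl_eq_one_sub (μ := gaussMeasure E)
    (Metric.isClosed_closedBall (x := (0 : E)) (ε := 4 * √(Module.finrank ℝ E))).measurableSet
  have h2 : (Metric.closedBall (0 : E) (4 * √(Module.finrank ℝ E)))ᶜ =
      {x | 4 * √(Module.finrank ℝ E) < ‖x‖} := by
    ext x; simp
  have h3 := gaussMeasure_norm_gt_le hE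
  rw [← h2, h] at h3
  have h4 : (1 : ENNReal) = ENNReal.ofReal (1 / 20) + ENNReal.ofReal (19 / 20) := by
    rw [← ENNReal.ofReal_add (by norm_num) (by norm_num)]; norm_num
  rw [tsub_le_iff_right, h4] at h3
  exact (ENNReal.add_le_add_iff_left ENNReal.ofReal_ne_top).1 h3

lemma gaussMeasure_translate_ge {s : Set E} (hs : MeasurableSet s) (hsymm : ∀ x ∈ s, -x ∈ s)
    (b : E) :
    ENNReal.ofReal (Real.exp (-‖b‖ ^ 2 / 2)) * gaussMeasure E s ≤
      gaussMeasure E {x | x - b ∈ s} := by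
  have hs' : MeasurableSet {x | x - b ∈ s} := measurable_sub_const b hs
  have hind : ∀ x, s.indicator (1 : E → ENNReal) (-x) = s.indicator 1 x := by
    intro x
    by_cases hx : x ∈ s
    · simp [hx, hsymm x hx]
    · have : -x ∉ s := fun h => hx (by simpa using hsymm _ h)
      simp [hx, this]
  have m1 : ∀ c : E, Measurable fun x => ENNReal.ofReal (gaussDensity E (x + c)) *
      s.indicator 1 x := fun c =>
    (measurable_gaussDensity.comp (measurable_add_const c)).mul (measurable_one.indicator hs)
  have h1 : gaussMeasure E {x | x - b ∈ s} =
      ∫⁻ x, ENNReal.ofReal (gaussDensity E (x + b)) * s.indicator 1 x := by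
    rw [gaussMeasure_apply hs', ← lintegral_add_right_eq_self _ b]
    refine lintegral_congr fun x => ?_
    congr 1
    by_cases hx : x ∈ s <;> simp [hx]
  have h2 : gaussMeasure E {x | x - b ∈ s} =
      ∫⁻ x, ENNReal.ofReal (gaussDensity E (x + -b)) * s.indicator 1 x := by
    rw [h1, ← lintegral_neg_eq_self]
    refine lintegral_congr fun x => ?_
    rw [hind, ← gaussDensity_neg]
    congr 3
    abel
  have h3 : 2 * (ENNReal.ofReal (Real.exp (-‖b‖ ^ 2 / 2)) * gaussMeasure E s) ≤
      2 * gaussMeasure E {x | x - b ∈ s} := by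
    calc _ = ∫⁻ x, 2 * (ENNReal.ofReal (Real.exp (-‖b‖ ^ 2 / 2)) *
          (ENNReal.ofReal (gaussDensity E x) * s.indicator 1 x)) := by
          rw [lintegral_const_mul, lintegral_const_mul, gaussMeasure_apply hs]
          · simpa using m1 0
          · simpa using (m1 0).const_mul _
      _ ≤ ∫⁻ x, (ENNReal.ofReal (gaussDensity E (x + b)) * s.indicator 1 x +
            ENNReal.ofReal (gaussDensity E (x + -b)) * s.indicator 1 x) := by
          refine lintegral_mono fun x => ?_
          simp only
          rw [← add_mul, ← mul_assoc, ← mul_assoc]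
          gcongr
          rw [← ENNReal.ofReal_add (gaussDensity_nonneg _) (gaussDensity_nonneg _),
            show (2 : ENNReal) = ENNReal.ofReal 2 by simp, mul_assoc,
            ← ENNReal.ofReal_mul (by positivity), ← ENNReal.ofReal_mul (by positivity)]
          refine ENNReal.ofReal_le_ofReal ?_
          unfold gaussDensity
          have e1 : Real.exp (-‖x + b‖ ^ 2 / 2) =
              Real.exp (-‖b‖ ^ 2 / 2) * Real.exp (-‖x‖ ^ 2 / 2) * Real.exp (-⟪x, b⟫) := by
            rw [← Real.exp_add, ← Real.exp_add, norm_add_sq_real]; ring_nf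
          have e2 : Real.exp (-‖x + -b‖ ^ 2 / 2) =
              Real.exp (-‖b‖ ^ 2 / 2) * Real.exp (-‖x‖ ^ 2 / 2) * Real.exp ⟪x, b⟫ := by
            rw [← Real.exp_add, ← Real.exp_add, norm_add_sq_real]
            simp only [norm_neg, inner_neg_right]; ring_nf
          rw [e1, e2]
          have e3 : 2 ≤ Real.exp (-⟪x, b⟫) + Real.exp ⟪x, b⟫ := by
            have := Real.add_one_le_exp ⟪x, b⟫
            have := Real.add_one_le_exp (-⟪x, b⟫)
            linarith
          have e4 : 0 ≤ (2 * π) ^ (-(Module.finrank ℝ E / 2 : ℝ)) *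
            (Real.exp (-‖b‖ ^ 2 / 2) * Real.exp (-‖x‖ ^ 2 / 2)) := by positivity
          nlinarith
      _ = _ := by
          rw [lintegral_add_left (m1 b), ← h1, ← h2, two_mul]
  exact (ENNReal.mul_le_mul_iff_right (by norm_num) (by norm_num)).1 h3

open Complex in
lemma charFun_gaussMeasure (t : E) :
    charFun (gaussMeasure E) t = Complex.exp (-‖t‖ ^ 2 / 2) := by
  rw [charFun_apply, gaussMeasure,
    integral_withDensity_eq_integral_toReal_smul measurable_gaussDensity
      (ae_of_all _ fun x => ENNReal.ofReal_lt_top)]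
  have h := GaussianFourier.integral_cexp_neg_mul_sq_norm_add (V := E) (b := 1 / 2)
    (by norm_num) I t
  have : ∀ x : E, (ENNReal.ofReal (gaussDensity E x)).toReal • Complex.exp (⟪x, t⟫ * I) =
      ((2 * π : ℝ) ^ (-(Module.finrank ℝ E / 2 : ℝ)) : ℝ) *
        Complex.exp (-(1 / 2) * ‖x‖ ^ 2 + I * ⟪t, x⟫) := by
    intro x
    rw [ENNReal.toReal_ofReal (gaussDensity_nonneg _), gaussDensity, real_smul, ofReal_mul,
      mul_assoc, ofReal_exp, ← Complex.exp_add, real_inner_comm]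
    push_cast
    ring_nf
  simp_rw [this]
  rw [integral_const_mul, h, ← mul_assoc]
  have h2 : (((2 * π : ℝ) ^ (-(Module.finrank ℝ E / 2 : ℝ)) : ℝ) : ℂ) *
      ((π / (1 / 2) : ℂ) ^ (Module.finrank ℝ E / 2 : ℂ)) = 1 := by
    rw [show (π / (1 / 2) : ℂ) = ((2 * π : ℝ) : ℂ) by push_cast; ring,
      show (Module.finrank ℝ E / 2 : ℂ) = ((Module.finrank ℝ E / 2 : ℝ) : ℂ) by push_cast; ring,
      ← ofReal_cpow (by positivity), ← ofReal_mul, ← Real.rpow_add (by positivity)]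
    simp
  rw [h2, one_mul, I_sq]
  congr 1
  ring

end Gaussian

section Smoothing

variable {E : Type*} [NormedAddCommGroup E] [InnerProductSpace ℝ E] [FiniteDimensional ℝ E]
  [MeasurableSpace E] [BorelSpace E]

open Pointwise in
/-- If `A` lies in the `s`-neighborhood of a symmetric convex set `P` which has a large Gaussian
measure after a contraction, then the volume of `A` is not much larger than that of `P`. -/
lemma volume_le_of_subset_neighborhood {P A : Set E} (hPm : MeasurableSet P) (hPc : Convex ℝ P)
    (hPs : ∀ x ∈ P, -x ∈ P) {δ s : ℝ} (hδ : 0 < δ)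
    (hA : ∀ y ∈ A, ∃ p ∈ P, ‖y - p‖ ≤ s) (hAm : MeasurableSet A) :
    ENNReal.ofReal (Real.exp (-s ^ 2 / 2)) * gaussMeasure E {x | δ⁻¹ • x ∈ P} * volume A ≤
      ENNReal.ofReal ((1 + δ) ^ Module.finrank ℝ E) * volume P := by
  set Q : Set E := (1 + δ) • P with hQ
  have h1δ : (1 + δ) ≠ 0 := by positivity
  have hQm : MeasurableSet Q := hPm.const_smul₀ _
  set S : Set E := {x | δ⁻¹ • x ∈ P} with hS
  have hSm : MeasurableSet S := (measurable_const_smul δ⁻¹) hPm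
  have hSs : ∀ x ∈ S, -x ∈ S := by
    intro x hx
    have := hPs _ hx
    simpa [hS] using this
  have key : ∀ y ∈ A, ENNReal.ofReal (Real.exp (-s ^ 2 / 2)) * gaussMeasure E S ≤
      gaussMeasure E {x | x - y ∈ Q} := by
    intro y hy
    obtain ⟨p, hp, hps⟩ := hA y hy
    calc _ ≤ ENNReal.ofReal (Real.exp (-‖y - p‖ ^ 2 / 2)) * gaussMeasure E S := by
          gcongr
      _ ≤ gaussMeasure E {x | x - (y - p) ∈ S} := gaussMeasure_translate_ge hSm hSs _
      _ ≤ _ := by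
          refine measure_mono fun x hx => ?_
          have hx' : δ⁻¹ • (x - (y - p)) ∈ P := hx
          refine ⟨(δ / (1 + δ)) • (δ⁻¹ • (x - (y - p))) + (1 / (1 + δ)) • (-p), ?_, ?_⟩
          · exact hPc hx' (hPs p hp) (by positivity) (by positivity) (by field_simp; ring)
          · simp only [smul_add, smul_smul]
            rw [show (1 + δ) * (δ / (1 + δ) * δ⁻¹) = 1 by field_simp,
              show (1 + δ) * (1 / (1 + δ)) = 1 by field_simp]
            simp only [one_smul]
            abel
  have hmeas : Measurable (Function.uncurry fun (y x : E) =>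
      Q.indicator (1 : E → ENNReal) (x - y)) := by
    refine (measurable_one.indicator hQm).comp ?_
    exact measurable_snd.sub measurable_fst
  have happly : ∀ y, gaussMeasure E {x | x - y ∈ Q} =
      ∫⁻ x, Q.indicator (1 : E → ENNReal) (x - y) ∂gaussMeasure E := by
    intro y
    have h : MeasurableSet {x | x - y ∈ Q} := (measurable_sub_const y) hQm
    rw [← lintegral_indicator_one h]
    rfl
  calc _ = ∫⁻ y in A, ENNReal.ofReal (Real.exp (-s ^ 2 / 2)) * gaussMeasure E S := by
        rw [setLIntegral_const]
    _ ≤ ∫⁻ y in A, gaussMeasure E {x | x - y ∈ Q} := setLIntegral_mono' hAm key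
    _ ≤ ∫⁻ y, gaussMeasure E {x | x - y ∈ Q} := setLIntegral_le_lintegral _ _
    _ = ∫⁻ x, (∫⁻ y, Q.indicator (1 : E → ENNReal) (x - y)) ∂gaussMeasure E := by
        simp_rw [happly]
        exact lintegral_lintegral_swap hmeas.aemeasurable
    _ = ∫⁻ x, volume Q ∂gaussMeasure E := by
        refine lintegral_congr fun x => ?_
        rw [lintegral_sub_left_eq_self (fun y => Q.indicator (1 : E → ENNReal) y) x,
          lintegral_indicator_one hQm]
    _ = volume Q := by simp
    _ = _ := by
        rw [hQ, Measure.addHaar_smul, abs_of_nonneg (by positivity)]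

end Smoothing

section MassBody

set_option linter.unusedSectionVars false

variable {E : Type*} [NormedAddCommGroup E] [InnerProductSpace ℝ E] [FiniteDimensional ℝ E]
  [MeasurableSpace E] [BorelSpace E]

/-- The mass of the ball of radius `2√d` around `x`. -/
def ballMass (ν : Measure E) (x : E) : ℝ :=
  ν.real (Metric.closedBall x (2 * √(Module.finrank ℝ E)))

/-- The set of centers of balls of radius `2√d` with mass at least `exp (-5d)`. -/
def massBody (ν : Measure E) : Set E :=
  {x | Real.exp (-(5 * Module.finrank ℝ E)) ≤ ballMass ν x}

/-- An even log-concave probability measure for which the ball of radius `√d` carries most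
of the mass. -/
structure IsConcentrated (ν : Measure E) : Prop where
  isProbabilityMeasure : IsProbabilityMeasure ν
  isLogConcaveMeasure : IsLogConcaveMeasure ν
  even : ∀ A : Set E, MeasurableSet A → ν A = ν {x | -x ∈ A}
  mass : 3 / 4 ≤ ν.real (Metric.closedBall 0 √(Module.finrank ℝ E))
  one_le_finrank : 1 ≤ Module.finrank ℝ E

lemma ballMass_nonneg (ν : Measure E) (x : E) : 0 ≤ ballMass ν x := measureReal_nonneg

lemma ballMass_combo {ν : Measure E} [IsProbabilityMeasure ν] (hν : IsLogConcaveMeasure ν)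
    {l : ℝ} (hl : l ∈ Set.Ioo (0:ℝ) 1) (x y : E) :
    ballMass ν x ^ (1 - l) * ballMass ν y ^ l ≤ ballMass ν ((1 - l) • x + l • y) := by
  set r := 2 * √(Module.finrank ℝ E) with hr
  have h := hν l hl (Metric.closedBall x r) (Metric.closedBall y r)
    (Metric.closedBall ((1 - l) • x + l • y) r) Metric.isClosed_closedBall.measurableSet
    Metric.isClosed_closedBall.measurableSet Metric.isClosed_closedBall.measurableSet
    (fun a ha b hb => by
      rw [Metric.mem_closedBall, dist_eq_norm] at *
      have h1 : (1 - l) • a + l • b - ((1 - l) • x + l • y) =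
        (1 - l) • (a - x) + l • (b - y) := by module
      rw [h1]
      refine (norm_add_le _ _).trans ?_
      rw [norm_smul, norm_smul, Real.norm_of_nonneg (by linarith [hl.2] : 0 ≤ 1 - l),
        Real.norm_of_nonneg hl.1.le]
      have h2 : 0 ≤ 1 - l := by linarith [hl.2]
      nlinarith [mul_le_mul_of_nonneg_left ha h2, mul_le_mul_of_nonneg_left hb hl.1.le])
  have h2 := ENNReal.toReal_mono (measure_ne_top _ _) h
  rwa [ENNReal.toReal_mul, ← ENNReal.toReal_rpow, ← ENNReal.toReal_rpow] at h2

namespace IsConcentrated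

variable {ν : Measure E}

lemma ballMass_le_one (hν : IsConcentrated ν) (x : E) : ballMass ν x ≤ 1 := by
  have := hν.isProbabilityMeasure
  exact measureReal_le_one

lemma ballMass_neg (hν : IsConcentrated ν) (x : E) : ballMass ν (-x) = ballMass ν x := by
  unfold ballMass Measure.real
  rw [hν.even _ Metric.isClosed_closedBall.measurableSet]
  congr 2
  ext y
  simp only [Metric.mem_closedBall, Set.mem_ofPred_eq, dist_neg_neg]

lemma ballMass_ge_of_norm_le (hν : IsConcentrated ν) {x : E}
    (hx : ‖x‖ ≤ √(Module.finrank ℝ E)) : 3 / 4 ≤ ballMass ν x := by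
  have := hν.isProbabilityMeasure
  refine hν.mass.trans (measureReal_mono ?_)
  refine Metric.closedBall_subset_closedBall' ?_
  rw [dist_comm, dist_zero_right]
  linarith

lemma ballMass_smul_ge (hν : IsConcentrated ν) {l : ℝ} (hl : l ∈ Set.Ioo (0:ℝ) 1) (x : E) :
    3 / 4 * ballMass ν x ^ l ≤ ballMass ν (l • x) := by
  have := hν.isProbabilityMeasure
  have h := ballMass_combo hν.isLogConcaveMeasure hl 0 x
  rw [smul_zero, zero_add] at h
  refine le_trans ?_ h
  have h0 : 3 / 4 ≤ ballMass ν 0 := hν.ballMass_ge_of_norm_le (by simp)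
  have h1 : ballMass ν 0 ≤ ballMass ν 0 ^ (1 - l) :=
    Real.self_le_rpow_of_le_one (by linarith) (hν.ballMass_le_one 0) (by linarith [hl.1])
  have h2 : 0 ≤ ballMass ν x ^ l := Real.rpow_nonneg (ballMass_nonneg _ _) _
  exact mul_le_mul_of_nonneg_right (h0.trans h1) h2

lemma finrank_pos (hν : IsConcentrated ν) : (1 : ℝ) ≤ Module.finrank ℝ E := by
  exact_mod_cast hν.one_le_finrank

lemma closedBall_subset_massBody (hν : IsConcentrated ν) :
    Metric.closedBall 0 √(Module.finrank ℝ E) ⊆ massBody ν := by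
  intro x hx
  have h1 := hν.ballMass_ge_of_norm_le (x := x) (by simpa using hx)
  have h2 : Real.exp (-(5 * Module.finrank ℝ E)) ≤ 3 / 4 := by
    have h3 := hν.finrank_pos
    have h4 : Real.exp (-(5 * Module.finrank ℝ E)) ≤ Real.exp (-1) :=
      Real.exp_le_exp.2 (by linarith)
    have := Real.exp_neg_one_lt_d9
    linarith
  exact h2.trans h1

lemma neg_mem_massBody (hν : IsConcentrated ν) {x : E} (hx : x ∈ massBody ν) :
    -x ∈ massBody ν := by
  have hx' : Real.exp (-(5 * Module.finrank ℝ E)) ≤ ballMass ν x := hx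
  rw [← hν.ballMass_neg] at hx'
  exact hx'

lemma convex_massBody (hν : IsConcentrated ν) : Convex ℝ (massBody ν) := by
  have := hν.isProbabilityMeasure
  rw [convex_iff_forall_pos]
  intro x hx y hy a b ha hb hab
  obtain rfl : a = 1 - b := by linarith
  have h := ballMass_combo hν.isLogConcaveMeasure (l := b) ⟨hb, by linarith⟩ x y
  refine le_trans ?_ h
  have hx' : Real.exp (-(5 * Module.finrank ℝ E)) ≤ ballMass ν x := hx
  have hy' : Real.exp (-(5 * Module.finrank ℝ E)) ≤ ballMass ν y := hy
  calc _ = Real.exp (-(5 * Module.finrank ℝ E)) ^ (1 - b) *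
        Real.exp (-(5 * Module.finrank ℝ E)) ^ b := by
        rw [← Real.rpow_add (Real.exp_pos _)]; simp
    _ ≤ _ := by
        gcongr
        exact Real.rpow_nonneg (ballMass_nonneg _ _) _

lemma zero_mem_interior_massBody (hν : IsConcentrated ν) : (0 : E) ∈ interior (massBody ν) := by
  refine mem_interior.2 ⟨Metric.ball 0 √(Module.finrank ℝ E),
    Metric.ball_subset_closedBall.trans hν.closedBall_subset_massBody, Metric.isOpen_ball, ?_⟩
  have := hν.finrank_pos
  simp only [Metric.mem_ball, dist_self]
  positivity

lemma card_le_of_separated (hν : IsConcentrated ν) {u : ℝ} (hu : 5 < u) (t : Finset E)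
    (ht : ∀ x ∈ t, x ∈ massBody ν)
    (hsep : ∀ x ∈ t, ∀ y ∈ t, x ≠ y → u * √(Module.finrank ℝ E) < dist x y) :
    (t.card : ℝ) ≤ 4 / 3 * Real.exp (25 * Module.finrank ℝ E / u) := by
  have := hν.isProbabilityMeasure
  set d : ℝ := (Module.finrank ℝ E : ℝ) with hd
  have hd1 : 1 ≤ d := hν.finrank_pos
  set l : ℝ := 5 / u with hl
  have hu0 : 0 < u := by linarith
  have hlm : l ∈ Set.Ioo (0:ℝ) 1 := ⟨by positivity, by rw [hl, div_lt_one hu0]; exact hu⟩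
  have h1 : ∀ x ∈ t, 3 / 4 * Real.exp (-(25 * d / u)) ≤
      ν.real (Metric.closedBall (l • x) (2 * √d)) := by
    intro x hx
    refine le_trans ?_ (hν.ballMass_smul_ge hlm x)
    have hx' : Real.exp (-(5 * d)) ≤ ballMass ν x := ht x hx
    have : Real.exp (-(25 * d / u)) = Real.exp (-(5 * d)) ^ l := by
      rw [← Real.exp_mul, hl]; ring_nf
    rw [this]
    have := Real.rpow_le_rpow (Real.exp_pos _).le hx' hlm.1.le
    linarith
  have h2 : ∑ x ∈ t, ν.real (Metric.closedBall (l • x) (2 * √d)) ≤ 1 := by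
    rw [← measureReal_biUnion_finset]
    · exact measureReal_le_one
    · intro x hx y hy hxy
      refine Metric.closedBall_disjoint_closedBall ?_
      have := hsep x hx y hy hxy
      rw [dist_smul₀, Real.norm_of_nonneg hlm.1.le]
      have h3 : l * (u * √d) < l * dist x y := mul_lt_mul_of_pos_left this hlm.1
      have h4 : l * (u * √d) = 5 * √d := by rw [hl]; field_simp
      have h5 : 0 < √d := by positivity
      linarith
    · intro x _
      exact Metric.isClosed_closedBall.measurableSet
  have h3 := Finset.sum_le_sum h1
  rw [Finset.sum_const, nsmul_eq_mul] at h3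
  have h4 : (t.card : ℝ) * (3 / 4 * Real.exp (-(25 * d / u))) ≤ 1 := h3.trans h2
  rw [Real.exp_neg] at h4
  have h5 := Real.exp_pos (25 * d / u)
  field_simp at h4
  linarith

lemma exists_net (hν : IsConcentrated ν) {u : ℝ} (hu : 5 < u) {S : Set E}
    (hS : S ⊆ massBody ν) :
    ∃ t : Finset E, (∀ x ∈ t, x ∈ S) ∧
      (t.card : ℝ) ≤ 4 / 3 * Real.exp (25 * Module.finrank ℝ E / u) ∧
      ∀ x ∈ S, ∃ y ∈ t, dist x y ≤ u * √(Module.finrank ℝ E) := by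
  classical
  set p : ℕ → Prop := fun m => ∃ t : Finset E, t.card = m ∧ (∀ x ∈ t, x ∈ S) ∧
    (∀ x ∈ t, ∀ y ∈ t, x ≠ y → u * √(Module.finrank ℝ E) < dist x y) with hp
  have hp0 : p 0 := ⟨∅, by simp⟩
  have hbound : ∀ m, p m → m ≤ ⌊4 / 3 * Real.exp (25 * Module.finrank ℝ E / u)⌋₊ := by
    rintro m ⟨t, rfl, htS, hsep⟩
    exact Nat.le_floor (hν.card_le_of_separated hu t (fun x hx => hS (htS x hx)) hsep)
  set N := Nat.findGreatest p ⌊4 / 3 * Real.exp (25 * Module.finrank ℝ E / u)⌋₊ with hN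
  obtain ⟨t, htN, htS, hsep⟩ : p N := Nat.findGreatest_spec (Nat.zero_le _) hp0
  refine ⟨t, htS, hν.card_le_of_separated hu t (fun x hx => hS (htS x hx)) hsep, ?_⟩
  intro x hx
  by_contra! hcon
  have hxt : x ∉ t := by
    intro hxt
    have h1 := hcon x hxt
    rw [dist_self] at h1
    have : 0 ≤ u * √(Module.finrank ℝ E) := by positivity
    linarith
  have hbig : p (N + 1) := by
    refine ⟨insert x t, by rw [Finset.card_insert_of_notMem hxt, htN], ?_, ?_⟩
    · intro y hy
      rcases Finset.mem_insert.1 hy with rfl | hy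
      · exact hx
      · exact htS y hy
    · intro y hy z hz hyz
      rcases Finset.mem_insert.1 hy with hyx | hy <;>
        rcases Finset.mem_insert.1 hz with hzx | hz
      · exact absurd (hyx.trans hzx.symm) hyz
      · rw [hyx]; exact hcon z hz
      · rw [hzx, dist_comm]; exact hcon y hy
      · exact hsep y hy z hz hyz
  have := Nat.le_findGreatest (hbound _ hbig) hbig
  omega

lemma norm_le_of_mem_massBody (hν : IsConcentrated ν) {x : E} (hx : x ∈ massBody ν) :
    ‖x‖ ≤ 100 * Module.finrank ℝ E * √(Module.finrank ℝ E) := by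
  classical
  set d : ℝ := (Module.finrank ℝ E : ℝ) with hd
  have hd1 : 1 ≤ d := hν.finrank_pos
  by_contra! hcon
  have hx0 : (0 : E) ≠ x := by
    rintro rfl
    rw [norm_zero] at hcon
    have : 0 ≤ 100 * d * √d := by positivity
    linarith
  have h := hν.card_le_of_separated (u := 100 * d) (by linarith) {0, x} (by
      intro y hy
      rcases Finset.mem_insert.1 hy with rfl | hy
      · exact interior_subset hν.zero_mem_interior_massBody
      · rw [Finset.mem_singleton.1 hy]; exact hx) (by
      intro y hy z hz hyz
      simp only [Finset.mem_insert, Finset.mem_singleton] at hy hz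
      rcases hy with rfl | rfl <;> rcases hz with rfl | rfl
      · exact absurd rfl hyz
      · simpa using hcon
      · simpa using hcon
      · exact absurd rfl hyz)
  rw [Finset.card_pair hx0, ← hd, show 25 * d / (100 * d) = 1 / 4 by field_simp; norm_num] at h
  have h2 : Real.exp (1 / 4) < 1.5 := by
    by_contra! h3
    have h4 : Real.exp (1 / 4) ^ 4 = Real.exp 1 := by rw [← Real.exp_nat_mul]; norm_num
    have h5 : (1.5 : ℝ) ^ 4 ≤ Real.exp (1 / 4) ^ 4 := by gcongr
    have := Real.exp_one_lt_d9
    rw [h4] at h5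
    norm_num at h5
    linarith
  norm_num at h
  linarith

end IsConcentrated

end MassBody

section LaplaceBound

set_option linter.unusedSectionVars false

variable {E : Type*} [NormedAddCommGroup E] [InnerProductSpace ℝ E] [FiniteDimensional ℝ E]
  [MeasurableSpace E] [BorelSpace E]

lemma exp_inner_mul_volume_le (ξ y : E) (r : ℝ) :
    ENNReal.ofReal (Real.exp ⟪ξ, y⟫) * volume (Metric.closedBall (0 : E) r) ≤
      ∫⁻ x, ENNReal.ofReal (Real.exp ⟪ξ, x⟫) *
        (Metric.closedBall (0 : E) r).indicator 1 (x - y) := by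
  set I : E → ENNReal := (Metric.closedBall (0 : E) r).indicator 1 with hI
  have hIm : Measurable I := measurable_one.indicator Metric.isClosed_closedBall.measurableSet
  have hIneg : ∀ z, I (-z) = I z := by
    intro z
    by_cases hz : ‖z‖ ≤ r <;> simp [hI, hz]
  have h1 : ∫⁻ x, ENNReal.ofReal (Real.exp ⟪ξ, x⟫) * I (x - y) =
      ∫⁻ z, ENNReal.ofReal (Real.exp ⟪ξ, y + z⟫) * I z := by
    rw [← lintegral_add_left_eq_self _ y]
    simp
  have h2 : ∫⁻ x, ENNReal.ofReal (Real.exp ⟪ξ, x⟫) * I (x - y) =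
      ∫⁻ z, ENNReal.ofReal (Real.exp ⟪ξ, y - z⟫) * I z := by
    rw [h1, ← lintegral_neg_eq_self]
    refine lintegral_congr fun z => ?_
    rw [hIneg, ← sub_eq_add_neg]
  have h3 : 2 * (ENNReal.ofReal (Real.exp ⟪ξ, y⟫) * volume (Metric.closedBall (0 : E) r)) ≤
      2 * ∫⁻ x, ENNReal.ofReal (Real.exp ⟪ξ, x⟫) * I (x - y) := by
    calc _ = ∫⁻ z, 2 * (ENNReal.ofReal (Real.exp ⟪ξ, y⟫) * I z) := by
          rw [lintegral_const_mul _ (hIm.const_mul _), lintegral_const_mul _ hIm, hI,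
            lintegral_indicator_one Metric.isClosed_closedBall.measurableSet]
      _ ≤ ∫⁻ z, (ENNReal.ofReal (Real.exp ⟪ξ, y + z⟫) * I z +
            ENNReal.ofReal (Real.exp ⟪ξ, y - z⟫) * I z) := by
          refine lintegral_mono fun z => ?_
          simp only
          rw [← add_mul, ← mul_assoc]
          gcongr
          rw [← ENNReal.ofReal_add (Real.exp_pos _).le (Real.exp_pos _).le,
            show (2 : ENNReal) = ENNReal.ofReal 2 by simp, ← ENNReal.ofReal_mul (by norm_num)]
          refine ENNReal.ofReal_le_ofReal ?_
          rw [inner_add_right, inner_sub_right, Real.exp_add, Real.exp_sub, div_eq_mul_inv,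
            ← Real.exp_neg, ← mul_add, mul_comm]
          have := Real.add_one_le_exp ⟪ξ, z⟫
          have := Real.add_one_le_exp (-⟪ξ, z⟫)
          gcongr
          linarith
      _ = _ := by
          rw [lintegral_add_left (by fun_prop), ← h1, ← h2, two_mul]
  exact (ENNReal.mul_le_mul_iff_right (by norm_num) (by norm_num)).1 h3

namespace IsConcentrated

variable {ν : Measure E}

lemma ballMass_le_exp (hν : IsConcentrated ν) {ξ : E}
    (hξ : ∀ x ∈ massBody ν, ⟪ξ, x⟫ ≤ (Module.finrank ℝ E : ℝ)) (x : E) :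
    ballMass ν x ≤ Real.exp (2 * Module.finrank ℝ E - 2 * ⟪ξ, x⟫) := by
  set d : ℝ := (Module.finrank ℝ E : ℝ) with hd
  have hd1 : 1 ≤ d := hν.finrank_pos
  by_cases h : ⟪ξ, x⟫ ≤ d
  · refine (hν.ballMass_le_one x).trans (Real.one_le_exp (by linarith))
  push Not at h
  set τ : ℝ := (1 + ⟪ξ, x⟫ / d) / 2 with hτ
  have hτ1 : 1 < τ := by
    have : 1 < ⟪ξ, x⟫ / d := by rw [one_lt_div (by linarith)]; exact h
    linarith
  have hτd : d * τ = (d + ⟪ξ, x⟫) / 2 := by rw [hτ]; field_simp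
  have hl : τ⁻¹ ∈ Set.Ioo (0:ℝ) 1 := ⟨by positivity, inv_lt_one_of_one_lt₀ hτ1⟩
  have hnot : τ⁻¹ • x ∉ massBody ν := by
    intro hmem
    have h1 := hξ _ hmem
    rw [inner_smul_right, inv_mul_le_iff₀ (by linarith)] at h1
    nlinarith
  have h1 : ballMass ν (τ⁻¹ • x) < Real.exp (-(5 * d)) := not_le.1 hnot
  have h2 := hν.ballMass_smul_ge hl x
  have h3 : ballMass ν x ^ τ⁻¹ ≤ Real.exp (-(4 * d)) := by
    have h4 : Real.exp (-(5 * d)) = Real.exp (-(4 * d)) * Real.exp (-d) := by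
      rw [← Real.exp_add]; ring_nf
    have h5 : Real.exp (-d) ≤ Real.exp (-1) := Real.exp_le_exp.2 (by linarith)
    have h6 := Real.exp_neg_one_lt_d9
    have h7 := Real.exp_pos (-(4 * d))
    nlinarith
  have h4 : ballMass ν x = (ballMass ν x ^ τ⁻¹) ^ τ := by
    rw [← Real.rpow_mul (ballMass_nonneg _ _), inv_mul_cancel₀ (by linarith), Real.rpow_one]
  rw [h4]
  refine (Real.rpow_le_rpow (Real.rpow_nonneg (ballMass_nonneg _ _) _) h3 (by linarith)).trans ?_
  rw [← Real.exp_mul]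
  refine Real.exp_le_exp.2 ?_
  nlinarith

lemma exp_inner_mul_ballMass_le (hν : IsConcentrated ν) {ξ : E}
    (hξ : ∀ x ∈ massBody ν, ⟪ξ, x⟫ ≤ (Module.finrank ℝ E : ℝ)) (x : E) :
    Real.exp ⟪ξ, x⟫ * ballMass ν x ≤
      2 * Real.exp (Module.finrank ℝ E) * ballMass ν ((1 / 2 : ℝ) • x) := by
  have h1 := hν.ballMass_le_exp hξ x
  set d : ℝ := (Module.finrank ℝ E : ℝ) with hd
  have h2 := hν.ballMass_smul_ge (l := 1 / 2) ⟨by norm_num, by norm_num⟩ x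
  rw [← Real.sqrt_eq_rpow] at h2
  have h3 : √(ballMass ν x) ≤ Real.exp (d - ⟪ξ, x⟫) := by
    rw [Real.sqrt_le_left (Real.exp_pos _).le, ← Real.exp_nat_mul]
    refine h1.trans (Real.exp_le_exp.2 ?_)
    push_cast; linarith
  have h4 : ballMass ν x = √(ballMass ν x) * √(ballMass ν x) :=
    (Real.mul_self_sqrt (ballMass_nonneg _ _)).symm
  calc Real.exp ⟪ξ, x⟫ * ballMass ν x
      = Real.exp ⟪ξ, x⟫ * √(ballMass ν x) * √(ballMass ν x) := by rw [mul_assoc, ← h4]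
    _ ≤ Real.exp ⟪ξ, x⟫ * Real.exp (d - ⟪ξ, x⟫) * √(ballMass ν x) := by gcongr
    _ = Real.exp d * √(ballMass ν x) := by rw [← Real.exp_add]; ring_nf
    _ ≤ Real.exp d * (2 * ballMass ν ((1 / 2 : ℝ) • x)) := by
        gcongr
        have := Real.sqrt_nonneg (ballMass ν x)
        linarith
    _ = _ := by ring

lemma lintegral_exp_inner_le (hν : IsConcentrated ν) {ξ : E}
    (hξ : ∀ x ∈ massBody ν, ⟪ξ, x⟫ ≤ (Module.finrank ℝ E : ℝ)) :
    ∫⁻ y, ENNReal.ofReal (Real.exp ⟪ξ, y⟫) ∂ν ≤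
      ENNReal.ofReal (Real.exp (3 * Module.finrank ℝ E)) := by
  have := hν.isProbabilityMeasure
  have hd1 : (1 : ℝ) ≤ (Module.finrank ℝ E : ℝ) := hν.finrank_pos
  set r : ℝ := 2 * √(Module.finrank ℝ E) with hr
  have hr0 : 0 < r := by positivity
  set I : E → ENNReal := (Metric.closedBall (0 : E) r).indicator 1 with hI
  have hIm : Measurable I := measurable_one.indicator Metric.isClosed_closedBall.measurableSet
  have hmass : ∀ x, ENNReal.ofReal (ballMass ν x) = ∫⁻ y, I (x - y) ∂ν := by
    intro x
    rw [ballMass, ofReal_measureReal, ← lintegral_indicator_one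
      Metric.isClosed_closedBall.measurableSet]
    refine lintegral_congr fun y => ?_
    rw [hI]
    by_cases hy : dist y x ≤ r
    · have hy' : ‖x - y‖ ≤ r := by rwa [← dist_eq_norm, dist_comm]
      rw [Set.indicator_of_mem (by simpa using hy), Set.indicator_of_mem (by simpa using hy')]
      rfl
    · have hy' : ¬ ‖x - y‖ ≤ r := by rwa [← dist_eq_norm, dist_comm]
      rw [Set.indicator_of_notMem (by simpa using hy),
        Set.indicator_of_notMem (by simpa using hy')]
  set B := volume (Metric.closedBall (0 : E) r) with hB
  have hB0 : B ≠ 0 := (Metric.measure_closedBall_pos _ _ hr0).ne'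
  have hBt : B ≠ ⊤ := measure_closedBall_lt_top.ne
  have hIint : ∀ y, ∫⁻ x, I (x - y) = B := by
    intro y
    rw [lintegral_sub_right_eq_self I y, hI,
      lintegral_indicator_one Metric.isClosed_closedBall.measurableSet]
  have hmassint : ∫⁻ x, ENNReal.ofReal (ballMass ν ((1 / 2 : ℝ) • x)) =
      ENNReal.ofReal (2 ^ Module.finrank ℝ E) * B := by
    simp_rw [hmass]
    rw [lintegral_lintegral_swap (by
      refine Measurable.aemeasurable (hIm.comp ?_)
      exact (measurable_fst.const_smul _).sub measurable_snd)]
    have : ∀ y : E, ∫⁻ x, I ((1 / 2 : ℝ) • x - y) = ENNReal.ofReal (2 ^ Module.finrank ℝ E) * B := by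
      intro y
      have hm : Measurable fun x => I (x - y) := hIm.comp (measurable_sub_const y)
      rw [← lintegral_map hm (measurable_const_smul (1 / 2 : ℝ)),
        Measure.map_addHaar_smul _ (by norm_num), lintegral_smul_measure, hIint, smul_eq_mul,
        abs_of_nonneg (by positivity)]
      simp
    simp_rw [this]
    simp
  have key : (∫⁻ y, ENNReal.ofReal (Real.exp ⟪ξ, y⟫) ∂ν) * B ≤
      ENNReal.ofReal (Real.exp (3 * Module.finrank ℝ E)) * B := by
    calc (∫⁻ y, ENNReal.ofReal (Real.exp ⟪ξ, y⟫) ∂ν) * B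
        = ∫⁻ y, ENNReal.ofReal (Real.exp ⟪ξ, y⟫) * B ∂ν := by
          rw [lintegral_mul_const' _ _ hBt]
      _ ≤ ∫⁻ y, (∫⁻ x, ENNReal.ofReal (Real.exp ⟪ξ, x⟫) * I (x - y)) ∂ν :=
          lintegral_mono fun y => exp_inner_mul_volume_le ξ y r
      _ = ∫⁻ x, (∫⁻ y, ENNReal.ofReal (Real.exp ⟪ξ, x⟫) * I (x - y) ∂ν) := by
          refine lintegral_lintegral_swap (Measurable.aemeasurable ?_)
          refine Measurable.mul (by fun_prop) (hIm.comp ?_)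
          exact measurable_snd.sub measurable_fst
      _ = ∫⁻ x, ENNReal.ofReal (Real.exp ⟪ξ, x⟫ * ballMass ν x) := by
          refine lintegral_congr fun x => ?_
          rw [lintegral_const_mul' _ _ ENNReal.ofReal_ne_top, ← hmass,
            ENNReal.ofReal_mul (Real.exp_pos _).le]
      _ ≤ ∫⁻ x, ENNReal.ofReal (2 * Real.exp (Module.finrank ℝ E)) *
            ENNReal.ofReal (ballMass ν ((1 / 2 : ℝ) • x)) := by
          refine lintegral_mono fun x => ?_
          rw [← ENNReal.ofReal_mul (by positivity)]
          exact ENNReal.ofReal_le_ofReal (hν.exp_inner_mul_ballMass_le hξ x)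
      _ = ENNReal.ofReal (2 * Real.exp (Module.finrank ℝ E)) *
            (ENNReal.ofReal (2 ^ Module.finrank ℝ E) * B) := by
          rw [lintegral_const_mul' _ _ ENNReal.ofReal_ne_top, hmassint]
      _ ≤ _ := by
          rw [← mul_assoc, ← ENNReal.ofReal_mul (by positivity)]
          gcongr
          have h1 : Real.exp (3 * Module.finrank ℝ E) =
            Real.exp 2 ^ Module.finrank ℝ E * Real.exp (Module.finrank ℝ E) := by
            rw [← Real.exp_nat_mul, ← Real.exp_add]; ring_nf
          have h2 : (4 : ℝ) ≤ Real.exp 2 := by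
            have h3 : Real.exp 2 = Real.exp 1 ^ 2 := by rw [← Real.exp_nat_mul]; norm_num
            have := Real.exp_one_gt_d9
            rw [h3]; nlinarith
          have h3 : (2 : ℝ) * 2 ^ Module.finrank ℝ E ≤ Real.exp 2 ^ Module.finrank ℝ E := by
            calc (2 : ℝ) * 2 ^ Module.finrank ℝ E
                ≤ 2 ^ Module.finrank ℝ E * 2 ^ Module.finrank ℝ E := by
                  gcongr
                  exact le_self_pow₀ (by norm_num) (by have := hν.one_le_finrank; omega)
              _ = 4 ^ Module.finrank ℝ E := by rw [← mul_pow]; norm_num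
              _ ≤ _ := by gcongr
          rw [h1]
          nlinarith [Real.exp_pos (Module.finrank ℝ E : ℝ)]
  exact (ENNReal.mul_le_mul_iff_left hB0 hBt).1 key

end IsConcentrated

end LaplaceBound

section Polar

set_option linter.unusedSectionVars false

variable {E : Type*} [NormedAddCommGroup E] [InnerProductSpace ℝ E] [FiniteDimensional ℝ E]
  [MeasurableSpace E] [BorelSpace E]

lemma mem_closure_of_forall_polar {K : Set E} (hK : Convex ℝ K) (h0 : (0 : E) ∈ K) {D : ℝ}
    (hD : 0 < D) {y : E} (hy : ∀ p : E, (∀ x ∈ K, ⟪p, x⟫ ≤ D) → ⟪p, y⟫ ≤ D) :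
    y ∈ closure K := by
  by_contra hcon
  obtain ⟨g, v, hg, hv⟩ := geometric_hahn_banach_closed_point hK.closure isClosed_closure hcon
  have hv0 : 0 < v := by simpa using hg 0 (subset_closure h0)
  set w := (InnerProductSpace.toDual ℝ E).symm g with hw
  have hwg : ∀ x, ⟪w, x⟫ = g x := fun x => InnerProductSpace.toDual_symm_apply
  have h1 := hy ((D / v) • w) (by
    intro x hx
    rw [real_inner_smul_left, hwg]
    calc D / v * g x ≤ D / v * v := by
          gcongr
          exact (hg x (subset_closure hx)).le
      _ = D := by field_simp)
  rw [real_inner_smul_left, hwg, div_mul_eq_mul_div, div_le_iff₀ hv0] at h1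
  have := le_of_mul_le_mul_left h1 hD
  linarith

open Pointwise in
/-- The polar of `K ∩ closedBall 0 r` lies in the sum of the polars of `K` and of the ball. -/
lemma exists_polar_near {K : Set E} (hK : Convex ℝ K) (h0 : (0 : E) ∈ interior K) {D r : ℝ}
    (hD : 0 < D) (hr : 0 < r) {ξ : E} (hξ : ∀ x ∈ K, ‖x‖ ≤ r → ⟪ξ, x⟫ ≤ D) :
    ∃ p : E, (∀ x ∈ K, ⟪p, x⟫ ≤ D) ∧ ‖ξ - p‖ ≤ D / r := by
  by_contra! hcon
  set Q : Set E := {p | ∀ x ∈ K, ⟪p, x⟫ ≤ D} with hQ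
  have hQc : Convex ℝ Q := by
    intro p hp p' hp' a b ha hb hab x hx
    rw [inner_add_left, real_inner_smul_left, real_inner_smul_left]
    have h1 := mul_le_mul_of_nonneg_left (hp x hx) ha
    have h2 := mul_le_mul_of_nonneg_left (hp' x hx) hb
    have h3 : a * D + b * D = D := by rw [← add_mul, hab, one_mul]
    linarith
  have hQcl : IsClosed Q := by
    have : Q = ⋂ x ∈ K, {p | ⟪p, x⟫ ≤ D} := by ext; simp [hQ]
    rw [this]
    exact isClosed_biInter fun x _ => isClosed_le (by fun_prop) continuous_const
  have hQ0 : (0 : E) ∈ Q := fun x _ => by simpa using hD.le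
  have hnot : ξ ∉ Q + Metric.closedBall (0 : E) (D / r) := by
    rintro ⟨p, hp, b, hb, hpb⟩
    have h1 := hcon p hp
    have h2 : ‖b‖ ≤ D / r := by simpa using hb
    rw [← hpb] at h1
    simp at h1
    linarith
  obtain ⟨f, u, hf, hu⟩ := geometric_hahn_banach_closed_point
    (hQc.add (convex_closedBall _ _))
    (hQcl.add_right_of_isCompact (isCompact_closedBall (0 : E) (D / r))) hnot
  have hu0 : 0 < u := by
    have := hf 0 ⟨0, hQ0, 0, by simp; positivity, by simp⟩
    simpa using this
  set w := (InnerProductSpace.toDual ℝ E).symm f with hw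
  have hwf : ∀ x, ⟪w, x⟫ = f x := fun x => InnerProductSpace.toDual_symm_apply
  have hy : (D / u) • w ∈ closure K := by
    refine mem_closure_of_forall_polar hK (interior_subset h0) hD fun p hp => ?_
    rw [real_inner_smul_right, real_inner_comm, hwf]
    have h1 := hf p ⟨p, hp, 0, by simp; positivity, by simp⟩
    calc D / u * f p ≤ D / u * u := by gcongr
      _ = D := by field_simp
  have hnorm : ‖(D / u) • w‖ ≤ r := by
    by_cases hw0 : w = 0
    · simp [hw0, hr.le]
    have hwn : 0 < ‖w‖ := norm_pos_iff.2 hw0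
    have h1 := hf ((D / r / ‖w‖) • w) ⟨0, hQ0, (D / r / ‖w‖) • w, by
      rw [mem_closedBall_zero_iff, norm_smul, Real.norm_of_nonneg (by positivity)]
      exact (by field_simp : D / r / ‖w‖ * ‖w‖ = D / r).le, by simp⟩
    rw [← hwf, real_inner_smul_right, real_inner_self_eq_norm_sq] at h1
    have h2 : D / r / ‖w‖ * ‖w‖ ^ 2 = D * ‖w‖ / r := by field_simp
    rw [h2, div_lt_iff₀ hr] at h1
    rw [norm_smul, Real.norm_of_nonneg (by positivity), div_mul_eq_mul_div, div_le_iff₀ hu0]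
    linarith
  set c := f ξ with hc
  have hc0 : 0 < c := hu0.trans hu
  have huc : u / c < 1 := by rwa [div_lt_one hc0]
  set θ : ℝ := (1 + u / c) / 2 with hθ
  have hθ1 : θ < 1 := by linarith
  have hθ0 : u / c < θ := by linarith
  have hθp : 0 < θ := lt_trans (by positivity) hθ0
  have hmem : θ • ((D / u) • w) ∈ interior K := by
    have := hK.combo_interior_closure_mem_interior h0 hy (a := 1 - θ) (b := θ)
      (by linarith) hθp.le (by ring)
    simpa using this
  have h1 := hξ _ (interior_subset hmem) (by
    rw [norm_smul, Real.norm_of_nonneg hθp.le]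
    have := norm_nonneg ((D / u) • w)
    nlinarith)
  rw [real_inner_smul_right, real_inner_smul_right, real_inner_comm, hwf, ← hc] at h1
  have h2 : D < θ * (D / u * c) := by
    rw [div_lt_iff₀ hc0] at hθ0
    calc D = D / u * u := by field_simp
      _ < D / u * (θ * c) := by gcongr
      _ = _ := by ring
  linarith

/-- The polar body of the part of `massBody ν` within distance `r` of the origin. -/
def truncPolar (ν : Measure E) (r : ℝ) : Set E :=
  {ξ | ∀ x ∈ massBody ν, ‖x‖ ≤ r → ⟪ξ, x⟫ ≤ (Module.finrank ℝ E : ℝ)}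

lemma isClosed_truncPolar (ν : Measure E) (r : ℝ) : IsClosed (truncPolar ν r) := by
  have : truncPolar ν r =
      ⋂ x ∈ massBody ν, ⋂ _ : ‖x‖ ≤ r, {ξ | ⟪ξ, x⟫ ≤ (Module.finrank ℝ E : ℝ)} := by
    ext; simp [truncPolar]
  rw [this]
  exact isClosed_biInter fun x _ => isClosed_iInter fun _ =>
    isClosed_le (by fun_prop) continuous_const

lemma convex_truncPolar (ν : Measure E) (r : ℝ) : Convex ℝ (truncPolar ν r) := by
  intro p hp p' hp' a b ha hb hab x hx hxr
  rw [inner_add_left, real_inner_smul_left, real_inner_smul_left]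
  have h1 := mul_le_mul_of_nonneg_left (hp x hx hxr) ha
  have h2 := mul_le_mul_of_nonneg_left (hp' x hx hxr) hb
  have h3 : a * (Module.finrank ℝ E : ℝ) + b * (Module.finrank ℝ E : ℝ) =
    Module.finrank ℝ E := by rw [← add_mul, hab, one_mul]
  linarith

namespace IsConcentrated

variable {ν : Measure E}

lemma neg_mem_truncPolar (hν : IsConcentrated ν) {r : ℝ} {ξ : E} (hξ : ξ ∈ truncPolar ν r) :
    -ξ ∈ truncPolar ν r := by
  intro x hx hxr
  have := hξ (-x) (hν.neg_mem_massBody hx) (by simpa using hxr)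
  simpa using this

lemma gaussMeasure_truncPolar_ge (hν : IsConcentrated ν) {q : ℝ} (hq : 2 ≤ q)
    (hqd : q ^ 6 ≤ 100 * Module.finrank ℝ E) :
    ENNReal.ofReal (1 / 2) ≤ gaussMeasure E
      {x | (1412 * q ^ 4)⁻¹ • x ∈ truncPolar ν (64 * q ^ 6 * √(Module.finrank ℝ E))} := by
  have hd1 := hν.finrank_pos
  have hq0 : 0 < q := by linarith
  set d : ℝ := (Module.finrank ℝ E : ℝ) with hd
  have hd0 : 0 < d := by linarith
  have hq4 : 5 < q ^ 4 := by
    have : (2 : ℝ) ^ 4 ≤ q ^ 4 := by gcongr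
    linarith
  have hq46 : q ^ 4 ≤ 100 * d := le_trans (pow_le_pow_right₀ (by linarith) (by norm_num)) hqd
  set r : ℝ := 64 * q ^ 6 * √d with hr
  have hr0 : 0 < r := by positivity
  set b : ℝ := 22 * √d / q ^ 2 with hb
  obtain ⟨t, htS, htc, htn⟩ := hν.exists_net hq4 (S := massBody ν ∩ {x | ‖x‖ ≤ r})
    Set.inter_subset_left
  set G : Set E := {x | (1412 * q ^ 4)⁻¹ • x ∈ truncPolar ν r} with hG
  have hGm : MeasurableSet G :=
    (measurable_const_smul _) (isClosed_truncPolar ν r).measurableSet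
  have hsub : Gᶜ ⊆ {x | 4 * √d < ‖x‖} ∪ ⋃ y ∈ t, {x | b * r < ⟪x, y⟫} := by
    intro x hx
    by_contra hcon
    simp only [Set.mem_union, Set.mem_iUnion, Set.mem_ofPred_eq, not_or, not_lt, not_exists]
      at hcon
    obtain ⟨hx1, hx2⟩ := hcon
    refine hx fun z hz hzr => ?_
    obtain ⟨y, hyt, hzy⟩ := htn z ⟨hz, hzr⟩
    rw [real_inner_smul_left, inv_mul_le_iff₀ (by positivity)]
    have h1 : ⟪x, z⟫ = ⟪x, y⟫ + ⟪x, z - y⟫ := by rw [← inner_add_right]; simp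
    have h2 : ⟪x, z - y⟫ ≤ 4 * √d * (q ^ 4 * √d) := by
      refine (real_inner_le_norm _ _).trans ?_
      rw [← dist_eq_norm]
      gcongr
    have h3 := hx2 y hyt
    have hs : √d * √d = d := Real.mul_self_sqrt hd0.le
    have h4 : b * r = 1408 * q ^ 4 * (√d * √d) := by
      rw [hb, hr]; field_simp; ring
    have h5 : 4 * √d * (q ^ 4 * √d) = 4 * q ^ 4 * (√d * √d) := by ring
    rw [h4, hs] at h3
    rw [h5, hs] at h2
    rw [h1]
    linarith
  have hexp : Real.exp (-2) ≤ 0.14 := by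
    have h3 : Real.exp (-2) = Real.exp (-1) ^ 2 := by rw [← Real.exp_nat_mul]; norm_num
    have := Real.exp_neg_one_lt_d9
    have := Real.exp_pos (-1)
    rw [h3]; nlinarith
  have hcompl : gaussMeasure E Gᶜ ≤ ENNReal.ofReal (1 / 2) := by
    calc gaussMeasure E Gᶜ ≤ gaussMeasure E {x | 4 * √d < ‖x‖} +
          gaussMeasure E (⋃ y ∈ t, {x | b * r < ⟪x, y⟫}) :=
          (measure_mono hsub).trans (measure_union_le _ _)
      _ ≤ ENNReal.ofReal (1 / 20) + ∑ y ∈ t, ENNReal.ofReal (Real.exp (-b ^ 2 / 2)) := by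
          gcongr
          · exact gaussMeasure_norm_gt_le hν.one_le_finrank
          · refine (measure_biUnion_finset_le t _).trans (Finset.sum_le_sum fun y hy => ?_)
            exact gaussMeasure_inner_gt_le y (by positivity) (htS y hy).2 hr0
      _ = ENNReal.ofReal (1 / 20 + t.card * Real.exp (-b ^ 2 / 2)) := by
          rw [Finset.sum_const, nsmul_eq_mul, ENNReal.ofReal_add (by norm_num) (by positivity),
            ENNReal.ofReal_mul (by positivity), ENNReal.ofReal_natCast]
      _ ≤ ENNReal.ofReal (1 / 2) := by
          refine ENNReal.ofReal_le_ofReal ?_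
          have h1 : (t.card : ℝ) * Real.exp (-b ^ 2 / 2) ≤
              4 / 3 * Real.exp (25 * d / q ^ 4) * Real.exp (-b ^ 2 / 2) := by gcongr
          have h2 : 4 / 3 * Real.exp (25 * d / q ^ 4) * Real.exp (-b ^ 2 / 2) ≤
              4 / 3 * Real.exp (-2) := by
            rw [mul_assoc, ← Real.exp_add]
            gcongr
            have h3 : b ^ 2 = 484 * (d / q ^ 4) := by
              rw [hb, div_pow, mul_pow, Real.sq_sqrt hd0.le]; ring
            have h4 : 25 * d / q ^ 4 = 25 * (d / q ^ 4) := by ring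
            have h5 : 1 / 100 ≤ d / q ^ 4 := by
              rw [div_le_div_iff₀ (by norm_num) (by positivity)]; linarith
            rw [h3, h4]
            linarith
          linarith
  have h1 : (1 : ENNReal) = gaussMeasure E G + gaussMeasure E Gᶜ := by
    rw [measure_add_measure_compl hGm, measure_univ]
  have h2 : ENNReal.ofReal (1 / 2) + ENNReal.ofReal (1 / 2) ≤
      gaussMeasure E G + ENNReal.ofReal (1 / 2) := by
    calc _ = (1 : ENNReal) := by
          rw [← ENNReal.ofReal_add (by norm_num) (by norm_num)]; norm_num
      _ = _ := h1
      _ ≤ _ := by gcongr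
  exact (ENNReal.add_le_add_iff_right ENNReal.ofReal_ne_top).1 h2

lemma volume_truncPolar_step (hν : IsConcentrated ν) {q : ℝ} (hq : 2 ≤ q)
    (hqd : q ^ 6 ≤ 100 * Module.finrank ℝ E) :
    volume (truncPolar ν (q ^ 6 * √(Module.finrank ℝ E))) ≤
      ENNReal.ofReal (Real.exp (1000000 * Module.finrank ℝ E / q)) *
        volume (truncPolar ν (64 * q ^ 6 * √(Module.finrank ℝ E))) := by
  have hd1 := hν.finrank_pos
  have hq0 : 0 < q := by linarith
  have hgauss := hν.gaussMeasure_truncPolar_ge hq hqd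
  set d : ℝ := (Module.finrank ℝ E : ℝ) with hd
  have hd0 : 0 < d := by linarith
  set τ : ℝ := 1412 * q ^ 5 with hτ
  have hτ0 : 0 < τ := by positivity
  set P := truncPolar ν (64 * q ^ 6 * √d) with hP
  set A := truncPolar ν (q ^ 6 * √d) with hA
  have hvol : ∀ S : Set E, volume {x | τ⁻¹ • x ∈ S} =
      ENNReal.ofReal (τ ^ Module.finrank ℝ E) * volume S := by
    intro S
    have := Measure.addHaar_preimage_smul (volume : Measure E) (inv_ne_zero hτ0.ne') S
    rw [abs_of_nonneg (by positivity), inv_pow, inv_inv] at this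
    exact this
  have hlin : Measurable fun x : E => τ⁻¹ • x := measurable_const_smul _
  have h := volume_le_of_subset_neighborhood (P := {x | τ⁻¹ • x ∈ P})
    (A := {x | τ⁻¹ • x ∈ A}) (δ := q⁻¹) (s := 1412 * √d / q)
    (hlin (isClosed_truncPolar ν _).measurableSet)
    (by
      have := (convex_truncPolar ν (64 * q ^ 6 * √d)).linear_preimage
        (τ⁻¹ • (LinearMap.id : E →ₗ[ℝ] E))
      exact this)
    (fun x hx => by
      have := hν.neg_mem_truncPolar hx
      simpa using this)
    (by positivity)
    (fun y hy => by
      obtain ⟨p, hp, hpn⟩ := exists_polar_near hν.convex_massBody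
        hν.zero_mem_interior_massBody hd0 (by positivity : 0 < q ^ 6 * √d) hy
      refine ⟨τ • p, ?_, ?_⟩
      · change τ⁻¹ • τ • p ∈ P
        rw [inv_smul_smul₀ hτ0.ne']
        exact fun x hx _ => hp x hx
      · have h1 : y - τ • p = τ • (τ⁻¹ • y - p) := by
          rw [smul_sub, smul_inv_smul₀ hτ0.ne']
        rw [h1, norm_smul, Real.norm_of_nonneg hτ0.le]
        calc τ * ‖τ⁻¹ • y - p‖ ≤ τ * (d / (q ^ 6 * √d)) := by gcongr
          _ = 1412 * (d / √d) / q := by rw [hτ]; field_simp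
          _ = _ := by rw [Real.div_sqrt])
    (hlin (isClosed_truncPolar ν _).measurableSet)
  rw [hvol, hvol] at h
  have hset : {x : E | (q⁻¹)⁻¹ • x ∈ {x | τ⁻¹ • x ∈ P}} = {x | (1412 * q ^ 4)⁻¹ • x ∈ P} := by
    ext x
    simp only [Set.mem_ofPred_eq, smul_smul]
    rw [show τ⁻¹ * (q⁻¹)⁻¹ = (1412 * q ^ 4)⁻¹ by rw [hτ]; field_simp]
  rw [hset] at h
  have hT0 : ENNReal.ofReal (τ ^ Module.finrank ℝ E) ≠ 0 := by
    simp only [ne_eq, ENNReal.ofReal_eq_zero, not_le]; positivity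
  have h2 : ENNReal.ofReal (Real.exp (-(1412 * √d / q) ^ 2 / 2)) * ENNReal.ofReal (1 / 2) *
      volume A ≤ ENNReal.ofReal ((1 + q⁻¹) ^ Module.finrank ℝ E) * volume P := by
    rw [← ENNReal.mul_le_mul_iff_right hT0 ENNReal.ofReal_ne_top]
    calc _ = ENNReal.ofReal (Real.exp (-(1412 * √d / q) ^ 2 / 2)) * ENNReal.ofReal (1 / 2) *
          (ENNReal.ofReal (τ ^ Module.finrank ℝ E) * volume A) := by ring
      _ ≤ _ := by gcongr
      _ ≤ _ := h
      _ = _ := by ring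
  set a : ℝ := Real.exp (-(1412 * √d / q) ^ 2 / 2) * (1 / 2) with ha
  have ha0 : 0 < a := by positivity
  rw [← ENNReal.ofReal_mul (Real.exp_pos _).le, ← ha] at h2
  have ha0' : ENNReal.ofReal a ≠ 0 := by simpa using ha0
  rw [← ENNReal.mul_le_mul_iff_right ha0' ENNReal.ofReal_ne_top]
  refine h2.trans ?_
  rw [← mul_assoc, ← ENNReal.ofReal_mul ha0.le]
  gcongr
  have e1 : (1 + q⁻¹) ^ Module.finrank ℝ E ≤ Real.exp (d / q) := by
    calc (1 + q⁻¹) ^ Module.finrank ℝ E ≤ Real.exp q⁻¹ ^ Module.finrank ℝ E := by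
          gcongr
          have := Real.add_one_le_exp q⁻¹
          linarith
      _ = Real.exp (d / q) := by rw [← Real.exp_nat_mul, ← hd]; ring_nf
  have e2 : Real.exp (-1) ≤ 1 / 2 := by
    have := Real.exp_neg_one_lt_d9
    linarith
  have hqq : q ≤ 100 * d := le_trans (le_self_pow₀ (by linarith) (by norm_num)) hqd
  have hx1 : 1 / 100 ≤ d / q := by
    rw [div_le_div_iff₀ (by norm_num) hq0]; linarith
  calc (1 + q⁻¹) ^ Module.finrank ℝ E ≤ Real.exp (d / q) := e1
    _ ≤ Real.exp (-(1412 * √d / q) ^ 2 / 2 + (-1) + 1000000 * d / q) := by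
        refine Real.exp_le_exp.2 ?_
        have h3 : (1412 * √d / q) ^ 2 = 1993744 * (d / q) / q := by
          rw [div_pow, mul_pow, Real.sq_sqrt hd0.le]; field_simp; norm_num
        have h4 : 1993744 * (d / q) / q ≤ 1993744 * (d / q) / 1 := by
          gcongr; linarith
        rw [neg_div, h3, mul_div_assoc 1000000]
        linarith
    _ = Real.exp (-(1412 * √d / q) ^ 2 / 2) * Real.exp (-1) * Real.exp (1000000 * d / q) := by
        rw [Real.exp_add, Real.exp_add]
    _ ≤ _ := by rw [ha]; gcongr

lemma truncPolar_eq_of_large (hν : IsConcentrated ν) {r : ℝ}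
    (hr : 100 * Module.finrank ℝ E * √(Module.finrank ℝ E) ≤ r) {ξ : E}
    (hξ : ξ ∈ truncPolar ν r) : ∀ x ∈ massBody ν, ⟪ξ, x⟫ ≤ (Module.finrank ℝ E : ℝ) :=
  fun x hx => hξ x hx ((hν.norm_le_of_mem_massBody hx).trans hr)

lemma volume_truncPolar_iterate (hν : IsConcentrated ν) (j : ℕ) :
    volume (truncPolar ν (64 * √(Module.finrank ℝ E))) ≤
      ENNReal.ofReal (Real.exp (1000000 * Module.finrank ℝ E * (1 - (2 ^ j)⁻¹))) *
        volume (truncPolar ν (64 ^ (j + 1) * √(Module.finrank ℝ E))) := by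
  have hd1 := hν.finrank_pos
  set d : ℝ := (Module.finrank ℝ E : ℝ) with hd
  induction j with
  | zero => simp
  | succ j ih =>
    by_cases hj : (64 : ℝ) ^ (j + 1) ≤ 100 * d
    · have hq6 : ((2 : ℝ) ^ (j + 1)) ^ 6 = 64 ^ (j + 1) := by
        rw [← pow_mul, mul_comm, pow_mul]; norm_num
      have hstep := hν.volume_truncPolar_step (q := 2 ^ (j + 1))
        (le_self_pow₀ (by norm_num) (by omega)) (by rw [hq6]; exact hj)
      rw [hq6, ← pow_succ', ← hd] at hstep
      refine ih.trans ((mul_le_mul_right hstep _).trans ?_)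
      rw [← mul_assoc, ← ENNReal.ofReal_mul (by positivity), ← Real.exp_add]
      refine mul_le_mul_left (ENNReal.ofReal_le_ofReal (Real.exp_le_exp.2 ?_)) _
      have : 1000000 * d * (1 - (2 ^ j)⁻¹) + 1000000 * d / 2 ^ (j + 1) =
          1000000 * d * (1 - (2 ^ (j + 1))⁻¹) := by
        field_simp; ring
      exact this.le
    · push Not at hj
      refine ih.trans ?_
      gcongr
      · norm_num
      · linarith
      · intro ξ hξ x hx _
        exact hν.truncPolar_eq_of_large (by rw [← hd]; gcongr) hξ x hx

/-- The sublevel set of the Laplace transform of a concentrated measure has large volume. -/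
lemma volume_sublevel_ge (hν : IsConcentrated ν) :
    ENNReal.ofReal ((Real.exp (-1000000) / 256) ^ Module.finrank ℝ E) ≤
      volume {ξ : E | ∫⁻ y, ENNReal.ofReal (Real.exp ⟪ξ, y⟫) ∂ν ≤
        ENNReal.ofReal (Real.exp (3 * Module.finrank ℝ E))} := by
  have hd1 := hν.finrank_pos
  set d : ℝ := (Module.finrank ℝ E : ℝ) with hd
  have hd0 : 0 < d := by linarith
  have hball : ENNReal.ofReal (256⁻¹ ^ Module.finrank ℝ E) ≤
      volume (truncPolar ν (64 * √d)) := by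
    have h1 : Metric.closedBall (0 : E) (256⁻¹ * (4 * √d)) ⊆ truncPolar ν (64 * √d) := by
      intro ξ hξ x _ hx
      have hξ' : ‖ξ‖ ≤ 256⁻¹ * (4 * √d) := by simpa using hξ
      refine (real_inner_le_norm _ _).trans ?_
      calc ‖ξ‖ * ‖x‖ ≤ (256⁻¹ * (4 * √d)) * (64 * √d) := by gcongr
        _ = √d * √d := by ring
        _ = d := Real.mul_self_sqrt hd0.le
    refine le_trans ?_ (measure_mono h1)
    rw [Measure.addHaar_closedBall_mul _ _ (by norm_num) (by positivity)]
    refine le_mul_of_one_le_right' ?_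
    have h2 := (gaussMeasure_closedBall_ge hν.one_le_finrank).trans
      (gaussMeasure_le_volume (Metric.closedBall (0 : E) (4 * √d)))
    by_contra! hlt
    have h3 : ENNReal.ofReal (19 / 20) ≤
        ENNReal.ofReal ((2 * π) ^ (-(Module.finrank ℝ E / 2 : ℝ))) := by
      refine h2.trans ?_
      calc _ ≤ ENNReal.ofReal ((2 * π) ^ (-(Module.finrank ℝ E / 2 : ℝ))) * 1 := by gcongr
        _ = _ := mul_one _
    rw [ENNReal.ofReal_le_ofReal_iff (by positivity)] at h3
    have h4 : (2 * π) ^ (-(Module.finrank ℝ E / 2 : ℝ)) ≤ (4 : ℝ) ^ (-(1 / 2) : ℝ) := by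
      have hpi := Real.pi_gt_three
      calc (2 * π) ^ (-(Module.finrank ℝ E / 2 : ℝ)) ≤ (2 * π) ^ (-(1 / 2) : ℝ) := by
            refine Real.rpow_le_rpow_of_exponent_le (by linarith) ?_
            rw [← hd]; linarith
        _ ≤ _ := Real.rpow_le_rpow_of_nonpos (by norm_num) (by linarith) (by norm_num)
    have h5 : (4 : ℝ) ^ (-(1 / 2) : ℝ) = 1 / 2 := by
      rw [show (4 : ℝ) = 2 ^ (2 : ℝ) by norm_num, ← Real.rpow_mul (by norm_num)]
      norm_num
    rw [h5] at h4
    linarith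
  obtain ⟨j, hj⟩ := pow_unbounded_of_one_lt (100 * d) (by norm_num : (1 : ℝ) < 64)
  have hj' : 100 * d ≤ 64 ^ (j + 1) := by
    refine hj.le.trans ?_
    gcongr
    · norm_num
    · omega
  have hsub : truncPolar ν (64 ^ (j + 1) * √d) ⊆
      {ξ : E | ∫⁻ y, ENNReal.ofReal (Real.exp ⟪ξ, y⟫) ∂ν ≤ ENNReal.ofReal (Real.exp (3 * d))} :=
    fun ξ hξ => hν.lintegral_exp_inner_le
      (hν.truncPolar_eq_of_large (by rw [← hd]; gcongr) hξ)
  refine le_trans ?_ (measure_mono hsub)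
  have h1 := hball.trans (hν.volume_truncPolar_iterate j)
  have h2 : ENNReal.ofReal (256⁻¹ ^ Module.finrank ℝ E) ≤
      ENNReal.ofReal (Real.exp (1000000 * d)) *
        volume (truncPolar ν (64 ^ (j + 1) * √d)) := by
    refine h1.trans (mul_le_mul_left (ENNReal.ofReal_le_ofReal (Real.exp_le_exp.2 ?_)) _)
    rw [← hd]
    have : (0 : ℝ) < (2 ^ j)⁻¹ := by positivity
    nlinarith
  have h3 : ENNReal.ofReal (Real.exp (1000000 * d)) ≠ 0 := by simp [Real.exp_pos]
  rw [← ENNReal.mul_le_mul_iff_right h3 ENNReal.ofReal_ne_top]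
  refine le_trans (le_of_eq ?_) h2
  rw [← ENNReal.ofReal_mul (Real.exp_pos _).le]
  congr 1
  rw [div_eq_mul_inv, mul_pow, ← mul_assoc, ← Real.exp_nat_mul, ← Real.exp_add, ← hd]
  ring_nf
  simp

end IsConcentrated

end Polar

/-- The sublevel set `{ξ | Λ_μ(2ξ) ≤ t²}` of the logarithmic Laplace transform. -/
def laplaceSublevel {n : ℕ} (μ : Measure (EucSp n)) (t : ℝ) : Set (EucSp n) :=
  {ξ : EucSp n | (∫⁻ x, ENNReal.ofReal (Real.exp ⟪(2:ℝ) • ξ, x⟫) ∂μ) ≤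
    ENNReal.ofReal (Real.exp (t ^ 2))}

lemma measurableSet_laplaceSublevel {n : ℕ} (μ : Measure (EucSp n)) [SFinite μ] (t : ℝ) :
    MeasurableSet (laplaceSublevel μ t) := by
  refine measurableSet_le (Measurable.lintegral_prod_right' (f := fun p : EucSp n × EucSp n =>
    ENNReal.ofReal (Real.exp ⟪(2:ℝ) • p.1, p.2⟫)) ?_) measurable_const
  fun_prop

lemma lintegral_exp_inner_div_three_le {n : ℕ} (μ : Measure (EucSp n)) [IsProbabilityMeasure μ]
    (ξ : EucSp n) :
    ∫⁻ x, ENNReal.ofReal (Real.exp ⟪(3⁻¹ : ℝ) • ξ, x⟫) ∂μ ≤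
      (∫⁻ x, ENNReal.ofReal (Real.exp ⟪ξ, x⟫) ∂μ) ^ (3⁻¹ : ℝ) := by
  have h := eLpNorm'_le_eLpNorm'_of_exponent_le (p := 1) (q := 3) one_pos (by norm_num) μ
    (f := fun x => Real.exp ⟪(3⁻¹ : ℝ) • ξ, x⟫) (by fun_prop)
  have h1 : ∀ x, ‖Real.exp ⟪(3⁻¹ : ℝ) • ξ, x⟫‖ₑ = ENNReal.ofReal (Real.exp ⟪(3⁻¹ : ℝ) • ξ, x⟫) :=
    fun x => Real.enorm_of_nonneg (Real.exp_pos _).le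
  have h3 : ∀ x, ENNReal.ofReal (Real.exp ⟪(3⁻¹ : ℝ) • ξ, x⟫) ^ (3 : ℝ) =
      ENNReal.ofReal (Real.exp ⟪ξ, x⟫) := by
    intro x
    rw [ENNReal.ofReal_rpow_of_nonneg (Real.exp_pos _).le (by norm_num), ← Real.exp_mul,
      real_inner_smul_left]
    congr 2; ring
  simp only [eLpNorm', h1, h3, ENNReal.rpow_one, div_one] at h
  simpa [one_div] using h

lemma IsIsotropic.lintegral_inner_sq {n : ℕ} {μ : Measure (EucSp n)} (hμ : IsIsotropic μ)
    (u : EucSp n) : ∫⁻ x, ENNReal.ofReal (⟪x, u⟫ ^ 2) ∂μ = ENNReal.ofReal (‖u‖ ^ 2) := by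
  have h := hμ.2 u u
  rw [real_inner_self_eq_norm_sq] at h
  simp_rw [← sq] at h
  by_cases hu : u = 0
  · simp [hu]
  rw [← h, ofReal_integral_eq_lintegral_ofReal]
  · by_contra hcon
    rw [integral_undef hcon] at h
    exact hu (norm_eq_zero.1 (pow_eq_zero_iff (by norm_num) |>.1 h.symm))
  · exact ae_of_all _ fun x => sq_nonneg _

lemma isConcentrated_map {n k : ℕ} (hn : 1 ≤ n) (hk : 1 ≤ k) {μ : Measure (EucSp n)}
    [IsProbabilityMeasure μ] (heven : IsEvenMeasure μ) (hlc : IsLogConcave μ)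
    (T : EucSp n →ₗ[ℝ] EucSp k)
    (hT : ∫⁻ x, ENNReal.ofReal (‖T x‖ ^ 2) ∂μ ≤ ENNReal.ofReal (16 * n * k)) :
    IsConcentrated (μ.map ((8 * √n)⁻¹ • T)) := by
  have hTm : Measurable ((8 * √n)⁻¹ • T) := (LinearMap.continuous_of_finiteDimensional _).measurable
  have hn0 : (0 : ℝ) < n := by exact_mod_cast hn
  have hk0 : (0 : ℝ) < k := by exact_mod_cast hk
  have hprob : IsProbabilityMeasure (μ.map ((8 * √n)⁻¹ • T)) :=
    Measure.isProbabilityMeasure_map hTm.aemeasurable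
  refine ⟨hprob, hlc.isLogConcaveMeasure.map _ hTm, ?_, ?_, ?_⟩
  · intro A hA
    have hA' : MeasurableSet {x | -x ∈ A} := measurable_neg hA
    rw [Measure.map_apply hTm hA, Measure.map_apply hTm hA', heven _ (hTm hA)]
    congr 1
    ext x
    simp [Set.mem_neg]
  · have hfin : Module.finrank ℝ (EucSp k) = k := by simp
    rw [hfin]
    have hTm' : Measurable T := (LinearMap.continuous_of_finiteDimensional _).measurable
    have h1 := mul_meas_ge_le_lintegral (μ := μ)
      (f := fun x => ENNReal.ofReal (‖T x‖ ^ 2)) (by fun_prop)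
      (ENNReal.ofReal (64 * n * k))
    have h2 : μ {x | ENNReal.ofReal (64 * n * k) ≤ ENNReal.ofReal (‖T x‖ ^ 2)} ≤
        ENNReal.ofReal (1 / 4) := by
      have h0 : ENNReal.ofReal (64 * n * k) ≠ 0 := by
        simp only [ne_eq, ENNReal.ofReal_eq_zero, not_le]; positivity
      rw [← ENNReal.mul_le_mul_iff_right h0 ENNReal.ofReal_ne_top]
      refine (h1.trans hT).trans (le_of_eq ?_)
      rw [← ENNReal.ofReal_mul (by positivity)]
      congr 1; ring
    set ν := μ.map ((8 * √n)⁻¹ • T) with hν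
    have h3 : ν (Metric.closedBall 0 √k)ᶜ ≤ ENNReal.ofReal (1 / 4) := by
      rw [hν, Measure.map_apply hTm Metric.isClosed_closedBall.measurableSet.compl]
      refine (measure_mono fun x hx => ?_).trans h2
      have hx' : √k < ‖((8 * √n)⁻¹ • T) x‖ := by simpa using hx
      refine ENNReal.ofReal_le_ofReal ?_
      rw [LinearMap.smul_apply, norm_smul, Real.norm_of_nonneg (by positivity),
        lt_inv_mul_iff₀ (by positivity)] at hx'
      have := pow_le_pow_left₀ (by positivity) hx'.le 2
      rw [mul_pow, mul_pow, Real.sq_sqrt hn0.le, Real.sq_sqrt hk0.le] at this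
      linarith
    have h4 := probReal_add_probReal_compl (μ := ν)
      (Metric.isClosed_closedBall (x := (0 : EucSp k)) (ε := √k)).measurableSet
    have h5 : ν.real (Metric.closedBall 0 √k)ᶜ ≤ 1 / 4 :=
      ENNReal.toReal_le_of_le_ofReal (by norm_num) h3
    linarith
  · simpa using hk

/-- Sections of the sublevel set by images of linear maps have large volume. -/
lemma volume_preimage_laplaceSublevel_ge {n k : ℕ} (hn : 1 ≤ n) (hk : 1 ≤ k)
    {μ : Measure (EucSp n)} [IsProbabilityMeasure μ] (heven : IsEvenMeasure μ)
    (hlc : IsLogConcave μ) {t : ℝ} (hkt : (k : ℝ) ≤ t ^ 2) (S : EucSp k →ₗ[ℝ] EucSp n)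
    (T : EucSp n →ₗ[ℝ] EucSp k) (hST : ∀ x v, ⟪T x, v⟫ = ⟪x, S v⟫)
    (hT : ∫⁻ x, ENNReal.ofReal (‖T x‖ ^ 2) ∂μ ≤ ENNReal.ofReal (16 * n * k)) :
    ENNReal.ofReal ((Real.exp (-1000000) / 256 / (48 * √n)) ^ k) ≤
      volume {v | S v ∈ laplaceSublevel μ t} := by
  have hn0 : (0 : ℝ) < n := by exact_mod_cast hn
  have h := (isConcentrated_map hn hk heven hlc T hT).volume_sublevel_ge
  have hfin : Module.finrank ℝ (EucSp k) = k := by simp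
  rw [hfin] at h
  have hTm : Measurable ((8 * √n)⁻¹ • T) :=
    (LinearMap.continuous_of_finiteDimensional _).measurable
  have hsub : {ξ : EucSp k | ∫⁻ y, ENNReal.ofReal (Real.exp ⟪ξ, y⟫)
        ∂(μ.map ((8 * √n)⁻¹ • T)) ≤ ENNReal.ofReal (Real.exp (3 * k))} ⊆
      {v | (48 * √n)⁻¹ • v ∈ {v | S v ∈ laplaceSublevel μ t}} := by
    intro v hv
    have hv' : ∫⁻ y, ENNReal.ofReal (Real.exp ⟪v, y⟫)
        ∂(μ.map ((8 * √n)⁻¹ • T)) ≤ ENNReal.ofReal (Real.exp (3 * k)) := hv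
    rw [lintegral_map (by fun_prop) hTm] at hv'
    have h1 : ∀ x, ⟪v, ((8 * √n)⁻¹ • T) x⟫ = ⟪(8 * √n)⁻¹ • S v, x⟫ := by
      intro x
      rw [LinearMap.smul_apply, real_inner_smul_right, real_inner_smul_left, real_inner_comm,
        hST, real_inner_comm]
    simp_rw [h1] at hv'
    change (∫⁻ x, ENNReal.ofReal (Real.exp ⟪(2:ℝ) • S ((48 * √n)⁻¹ • v), x⟫) ∂μ) ≤
      ENNReal.ofReal (Real.exp (t ^ 2))
    have h2 : (2:ℝ) • S ((48 * √n)⁻¹ • v) = (3⁻¹ : ℝ) • (8 * √n)⁻¹ • S v := by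
      rw [map_smul, smul_smul, smul_smul]
      congr 1
      field_simp; norm_num
    rw [h2]
    refine (lintegral_exp_inner_div_three_le μ _).trans ?_
    refine (ENNReal.rpow_le_rpow hv' (by norm_num)).trans ?_
    rw [ENNReal.ofReal_rpow_of_nonneg (Real.exp_pos _).le (by norm_num), ← Real.exp_mul]
    refine ENNReal.ofReal_le_ofReal (Real.exp_le_exp.2 ?_)
    linarith
  have h2 := h.trans (measure_mono hsub)
  have h3 := Measure.addHaar_preimage_smul (volume : Measure (EucSp k))
    (inv_ne_zero (by positivity : (48 * √(n:ℝ)) ≠ 0)) {v | S v ∈ laplaceSublevel μ t}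
  rw [abs_of_nonneg (by positivity), inv_pow, inv_inv, hfin] at h3
  have h4 : ENNReal.ofReal ((Real.exp (-1000000) / 256) ^ k) ≤
      ENNReal.ofReal ((48 * √n) ^ k) * volume {v | S v ∈ laplaceSublevel μ t} := h2.trans h3.le
  have h5 : ENNReal.ofReal ((48 * √n) ^ k) ≠ 0 := by
    simp only [ne_eq, ENNReal.ofReal_eq_zero, not_le]; positivity
  rw [← ENNReal.mul_le_mul_iff_right h5 ENNReal.ofReal_ne_top]
  refine le_trans (le_of_eq ?_) h4
  rw [← ENNReal.ofReal_mul (by positivity), div_pow (_ / 256)]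
  congr 1
  field_simp

lemma IsEvenMeasure.map_neg {n : ℕ} {μ : Measure (EucSp n)} (heven : IsEvenMeasure μ) :
    μ.map (fun x => -x) = μ := by
  ext A hA
  rw [Measure.map_apply measurable_neg hA, heven A hA]
  rfl

lemma volume_laplaceSublevel_ne_top {n : ℕ} {μ : Measure (EucSp n)}
    (heven : IsEvenMeasure μ) (hiso : IsIsotropic μ) (t : ℝ) :
    volume (laplaceSublevel μ t) ≠ ⊤ := by
  refine ((measure_mono (t := Metric.closedBall 0 (Real.exp (t ^ 2))) fun ξ hξ => ?_).trans_lt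
    (measure_closedBall_lt_top)).ne
  have hξ' : (∫⁻ x, ENNReal.ofReal (Real.exp ⟪(2:ℝ) • ξ, x⟫) ∂μ) ≤
    ENNReal.ofReal (Real.exp (t ^ 2)) := hξ
  have hneg : ∫⁻ x, ENNReal.ofReal (Real.exp (-⟪(2:ℝ) • ξ, x⟫)) ∂μ =
      ∫⁻ x, ENNReal.ofReal (Real.exp ⟪(2:ℝ) • ξ, x⟫) ∂μ := by
    conv_rhs => rw [← heven.map_neg]
    rw [lintegral_map (by fun_prop) measurable_neg]
    simp only [inner_neg_right]
  have h1 : ENNReal.ofReal (‖ξ‖ ^ 2) ≤ ENNReal.ofReal (Real.exp (t ^ 2)) := by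
    have h2 : ENNReal.ofReal (‖ξ‖ ^ 2 * 4) ≤ ENNReal.ofReal (Real.exp (t ^ 2) * 4) := by
      have h3 := hiso.lintegral_inner_sq ((2:ℝ) • ξ)
      rw [norm_smul, Real.norm_of_nonneg zero_le_two] at h3
      calc ENNReal.ofReal (‖ξ‖ ^ 2 * 4) = ENNReal.ofReal ((2 * ‖ξ‖) ^ 2) := by congr 1; ring
        _ = ∫⁻ x, ENNReal.ofReal (⟪x, (2:ℝ) • ξ⟫ ^ 2) ∂μ := h3.symm
        _ ≤ ∫⁻ x, ENNReal.ofReal 2 * (ENNReal.ofReal (Real.exp ⟪(2:ℝ) • ξ, x⟫) +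
              ENNReal.ofReal (Real.exp (-⟪(2:ℝ) • ξ, x⟫))) ∂μ := by
            refine lintegral_mono fun x => ?_
            rw [← ENNReal.ofReal_add (Real.exp_pos _).le (Real.exp_pos _).le,
              ← ENNReal.ofReal_mul zero_le_two, real_inner_comm]
            refine ENNReal.ofReal_le_ofReal ?_
            generalize ⟪(2:ℝ) • ξ, x⟫ = y
            have h4 := Real.exp_pos y
            have h5 := Real.exp_pos (-y)
            rcases le_total 0 y with hy | hy
            · nlinarith [Real.quadratic_le_exp_of_nonneg hy]
            · nlinarith [Real.quadratic_le_exp_of_nonneg (neg_nonneg.2 hy)]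
        _ ≤ ENNReal.ofReal 2 *
              (ENNReal.ofReal (Real.exp (t ^ 2)) + ENNReal.ofReal (Real.exp (t ^ 2))) := by
            rw [lintegral_const_mul _ (by fun_prop), lintegral_add_left (by fun_prop), hneg]
            gcongr
        _ = ENNReal.ofReal (Real.exp (t ^ 2) * 4) := by
            rw [← ENNReal.ofReal_add (Real.exp_pos _).le (Real.exp_pos _).le,
              ← ENNReal.ofReal_mul zero_le_two]
            congr 1; ring
    rw [ENNReal.ofReal_le_ofReal_iff (by positivity)] at h2
    exact ENNReal.ofReal_le_ofReal (by linarith)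
  rw [ENNReal.ofReal_le_ofReal_iff (Real.exp_pos _).le] at h1
  have h6 : 1 ≤ Real.exp (t ^ 2) := Real.one_le_exp (sq_nonneg t)
  rw [mem_closedBall_zero_iff]
  nlinarith [norm_nonneg ξ]

lemma gaussMeasure_map_eq_map_smul {E F : Type*} [NormedAddCommGroup E] [InnerProductSpace ℝ E]
    [FiniteDimensional ℝ E] [MeasurableSpace E] [BorelSpace E]
    [NormedAddCommGroup F] [InnerProductSpace ℝ F]
    [FiniteDimensional ℝ F] [MeasurableSpace F] [BorelSpace F]
    {L : E → F} (hL : Measurable L) (L' : F → E) (hLL' : ∀ x y, ⟪L x, y⟫ = ⟪x, L' y⟫) {s : ℝ}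
    (hs : ∀ y, ‖L' y‖ = s * ‖y‖) :
    (gaussMeasure E).map L = (gaussMeasure F).map (fun y => s • y) := by
  have := Measure.isProbabilityMeasure_map (μ := gaussMeasure E) hL.aemeasurable
  have hsm : Measurable (fun y : F => s • y) := measurable_const_smul s
  have := Measure.isProbabilityMeasure_map (μ := gaussMeasure F) hsm.aemeasurable
  refine Measure.ext_of_charFun ?_
  ext y
  rw [charFun_map_smul, charFun_gaussMeasure, charFun_apply,
    integral_map hL.aemeasurable (by fun_prop)]
  simp_rw [hLL']
  rw [← charFun_apply, charFun_gaussMeasure, hs, norm_smul]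
  congr 3
  push_cast
  rw [mul_pow, mul_pow, ← Complex.ofReal_pow, ← Complex.ofReal_pow ‖s‖, Real.norm_eq_abs, sq_abs]

lemma volume_closedBall_le {k : ℕ} (hk : 1 ≤ k) {r : ℝ} (hr : 0 ≤ r) :
    volume (Metric.closedBall (0 : EucSp k) r) ≤ ENNReal.ofReal ((5 * r / √k) ^ k) := by
  have hk0 : (0 : ℝ) < k := by exact_mod_cast hk
  have hfin : Module.finrank ℝ (EucSp k) = k := by simp
  have h1 : volume (Metric.closedBall (0 : EucSp k) √k) ≤ ENNReal.ofReal (5 ^ k) := by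
    have h2 : ENNReal.ofReal ((5 ^ k)⁻¹) * volume (Metric.closedBall (0 : EucSp k) √k) ≤ 1 := by
      have h3 : gaussMeasure (EucSp k) (Metric.closedBall 0 √k) ≤ 1 := prob_le_one
      refine le_trans ?_ h3
      rw [gaussMeasure, withDensity_apply _ Metric.isClosed_closedBall.measurableSet,
        ← setLIntegral_const]
      refine setLIntegral_mono measurable_gaussDensity fun x hx =>
        ENNReal.ofReal_le_ofReal ?_
      rw [mem_closedBall_zero_iff] at hx
      have hx2 : ‖x‖ ^ 2 ≤ k := by
        have := pow_le_pow_left₀ (norm_nonneg _) hx 2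
        rwa [Real.sq_sqrt hk0.le] at this
      rw [gaussDensity, hfin]
      have h4 : Real.exp (-(k/2)) ≤ Real.exp (-‖x‖ ^ 2 / 2) := Real.exp_le_exp.2 (by linarith)
      have h5 : ((5:ℝ) ^ k)⁻¹ ≤ (2 * π) ^ (-(k / 2 : ℝ)) * Real.exp (-(k/2)) := by
        have h6 : Real.exp (-(k/2 : ℝ)) = Real.exp 1 ^ (-(k / 2 : ℝ)) := by
          rw [← Real.exp_mul, one_mul]
        rw [h6, ← Real.mul_rpow (by positivity) (Real.exp_pos _).le, Real.rpow_neg (by positivity)]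
        refine inv_anti₀ (by positivity) ?_
        have h7 : ((5:ℝ) ^ 2) ^ (k / 2 : ℝ) = 5 ^ k := by
          rw [← Real.rpow_natCast, ← Real.rpow_mul (by norm_num), ← Real.rpow_natCast]
          congr 1; push_cast; ring
        rw [← h7]
        refine Real.rpow_le_rpow (by positivity) ?_ (by positivity)
        have := Real.pi_lt_d2
        have := Real.exp_one_lt_d9
        have := Real.pi_pos
        nlinarith [Real.exp_pos 1]
      exact h5.trans (mul_le_mul_of_nonneg_left h4 (by positivity))
    have h50 : ENNReal.ofReal ((5 ^ k)⁻¹) ≠ 0 := by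
      simp only [ne_eq, ENNReal.ofReal_eq_zero, not_le]; positivity
    rw [← ENNReal.mul_le_mul_iff_right h50 ENNReal.ofReal_ne_top]
    refine h2.trans (le_of_eq ?_)
    rw [← ENNReal.ofReal_mul (by positivity), inv_mul_cancel₀ (by positivity), ENNReal.ofReal_one]
  have h8 := Measure.addHaar_closedBall_mul (volume : Measure (EucSp k)) 0
    (r := r / √k) (by positivity) (s := √k) (by positivity)
  rw [div_mul_cancel₀ _ (by positivity), hfin] at h8
  rw [h8]
  refine (mul_le_mul_right h1 _).trans (le_of_eq ?_)
  rw [← ENNReal.ofReal_mul (by positivity), ← mul_pow]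
  congr 2; ring

lemma gaussMeasure_preimage_smul_le {n : ℕ} {P : Set (EucSp n)} {w : ℝ}
    (hP : volume P ≤ ENNReal.ofReal (w ^ n)) {s : ℝ} (hs : 0 < s) :
    gaussMeasure (EucSp n) {g | s • g ∈ P} ≤ ENNReal.ofReal ((w / s) ^ n) := by
  have hfin : Module.finrank ℝ (EucSp n) = n := by simp
  have h3 := Measure.addHaar_preimage_smul (volume : Measure (EucSp n)) hs.ne' P
  rw [hfin, abs_of_nonneg (by positivity)] at h3
  have h1 := gaussMeasure_le_volume (E := EucSp n) {g | s • g ∈ P}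
  have h2 : (2 * π) ^ (-(Module.finrank ℝ (EucSp n) / 2 : ℝ)) ≤ 1 := by
    refine Real.rpow_le_one_of_one_le_of_nonpos ?_ ?_
    · nlinarith [Real.pi_gt_three]
    · simp only [Left.neg_nonpos_iff]; positivity
  calc _ ≤ 1 * volume {g | s • g ∈ P} := by
        refine h1.trans ?_
        gcongr
        rwa [ENNReal.ofReal_le_one]
    _ = ENNReal.ofReal (s ^ n)⁻¹ * volume P := by rw [one_mul]; exact h3
    _ ≤ ENNReal.ofReal (s ^ n)⁻¹ * ENNReal.ofReal (w ^ n) := by gcongr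
    _ = _ := by
      rw [← ENNReal.ofReal_mul (by positivity)]
      congr 1
      rw [div_pow]; field_simp

lemma lintegral_gaussMeasure_preimage_smul_le {n k : ℕ} (hk : 1 ≤ k) (hkn : 2 * k ≤ n)
    {P : Set (EucSp n)} {w : ℝ} (hw : 0 < w) (hP : volume P ≤ ENNReal.ofReal (w ^ n)) :
    ∫⁻ v : EucSp k, gaussMeasure (EucSp n) {g | ‖v‖ • g ∈ P} ≤
      ENNReal.ofReal (2 * (10 * w / √k) ^ k) := by
  have hk0 : (0 : ℝ) < k := by exact_mod_cast hk
  have hpt : ∀ v : EucSp k, gaussMeasure (EucSp n) {g | ‖v‖ • g ∈ P} ≤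
      ∑' i : ℕ, (Metric.closedBall (0 : EucSp k) (2 ^ (i + 1) * w)).indicator
        (fun _ => ENNReal.ofReal ((4⁻¹ ^ k) ^ i)) v := by
    intro v
    rcases lt_or_ge ‖v‖ w with hv | hv
    · refine le_trans ?_ (ENNReal.le_tsum 0)
      rw [indicator_of_mem]
      · simpa using prob_le_one
      · rw [mem_closedBall_zero_iff, zero_add, pow_one]; linarith
    · have hv0 : 0 < ‖v‖ := hw.trans_le hv
      obtain ⟨i, hi1, hi2⟩ := exists_nat_pow_near ((one_le_div hw).2 hv) one_lt_two
      rw [le_div_iff₀ hw] at hi1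
      rw [div_lt_iff₀ hw] at hi2
      refine le_trans ?_ (ENNReal.le_tsum i)
      rw [indicator_of_mem]
      · refine (gaussMeasure_preimage_smul_le hP hv0).trans (ENNReal.ofReal_le_ofReal ?_)
        have h1 : w / ‖v‖ ≤ 1 := (div_le_one hv0).2 hv
        have h2 : w / ‖v‖ ≤ 2⁻¹ ^ i := by
          rw [div_le_iff₀ hv0, inv_pow, ← div_eq_inv_mul, le_div_iff₀ (by positivity)]
          linarith
        calc (w / ‖v‖) ^ n ≤ (w / ‖v‖) ^ (2 * k) := pow_le_pow_of_le_one (by positivity) h1 hkn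
          _ ≤ (2⁻¹ ^ i) ^ (2 * k) := by gcongr
          _ = (4⁻¹ ^ k) ^ i := by
            rw [← pow_mul, ← pow_mul, show i * (2 * k) = 2 * (k * i) by ring, pow_mul]
            norm_num
      · rw [mem_closedBall_zero_iff]; exact hi2.le
  calc _ ≤ ∫⁻ v : EucSp k, ∑' i : ℕ, (Metric.closedBall (0 : EucSp k) (2 ^ (i + 1) * w)).indicator
        (fun _ => ENNReal.ofReal ((4⁻¹ ^ k) ^ i)) v := lintegral_mono hpt
    _ = ∑' i : ℕ, ENNReal.ofReal ((4⁻¹ ^ k) ^ i) *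
        volume (Metric.closedBall (0 : EucSp k) (2 ^ (i + 1) * w)) := by
      rw [lintegral_tsum fun i => (measurable_const.indicator
        Metric.isClosed_closedBall.measurableSet).aemeasurable]
      congr 1
      ext i
      rw [lintegral_indicator_const Metric.isClosed_closedBall.measurableSet]
    _ ≤ ∑' i : ℕ, ENNReal.ofReal ((10 * w / √k) ^ k * (1 / 2) ^ i) := by
      refine ENNReal.tsum_le_tsum fun i => ?_
      refine (mul_le_mul_right (volume_closedBall_le hk (by positivity)) _).trans ?_
      rw [← ENNReal.ofReal_mul (by positivity)]
      refine ENNReal.ofReal_le_ofReal ?_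
      have h1 : (5 * (2 ^ (i + 1) * w) / √k) = 2 ^ i * (10 * w / √k) := by ring
      rw [h1, mul_pow, ← mul_assoc, mul_comm]
      refine mul_le_mul_of_nonneg_left ?_ (by positivity)
      have h2 : (((4:ℝ)⁻¹ ^ k) ^ i) * (2 ^ i) ^ k = ((1 / 2) ^ i) ^ k := by
        rw [pow_right_comm, ← mul_pow, ← mul_pow]; norm_num
      rw [h2]
      exact pow_le_of_le_one (by positivity) (pow_le_one₀ (by norm_num) (by norm_num)) (by lia)
    _ = ENNReal.ofReal (2 * (10 * w / √k) ^ k) := by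
      rw [← ENNReal.ofReal_tsum_of_nonneg (fun i => by positivity)
        (summable_geometric_two.mul_left _), tsum_mul_left, tsum_geometric_two, mul_comm]

/-- The action of a matrix with rows indexed by `Fin k` on row vectors. -/
def vecMulLin {n k : ℕ} (G : EuclideanSpace ℝ (Fin k × Fin n)) : EucSp k →ₗ[ℝ] EucSp n where
  toFun v := WithLp.toLp 2 fun i => ∑ j, G (j, i) * v j
  map_add' v w := by ext i; simp [mul_add, Finset.sum_add_distrib]
  map_smul' c v := by ext i; simp [Finset.mul_sum, mul_left_comm]

/-- The action of a matrix with rows indexed by `Fin k` on column vectors. -/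
def mulColLin {n k : ℕ} (G : EuclideanSpace ℝ (Fin k × Fin n)) : EucSp n →ₗ[ℝ] EucSp k where
  toFun x := WithLp.toLp 2 fun j => ∑ i, G (j, i) * x i
  map_add' v w := by ext i; simp [mul_add, Finset.sum_add_distrib]
  map_smul' c v := by ext i; simp [Finset.mul_sum, mul_left_comm]

lemma vecMulLin_apply {n k : ℕ} (G : EuclideanSpace ℝ (Fin k × Fin n)) (v : EucSp k) (i : Fin n) :
    vecMulLin G v i = ∑ j, G (j, i) * v j := rfl

lemma mulColLin_apply {n k : ℕ} (G : EuclideanSpace ℝ (Fin k × Fin n)) (x : EucSp n)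
    (j : Fin k) : mulColLin G x j = ∑ i, G (j, i) * x i := rfl

lemma inner_mulColLin {n k : ℕ} (G : EuclideanSpace ℝ (Fin k × Fin n)) (x : EucSp n)
    (v : EucSp k) : ⟪mulColLin G x, v⟫ = ⟪x, vecMulLin G v⟫ := by
  simp only [PiLp.inner_apply, vecMulLin_apply, mulColLin_apply, RCLike.inner_apply,
    conj_trivial, Finset.sum_mul, Finset.mul_sum]
  rw [Finset.sum_comm]
  refine Finset.sum_congr rfl fun i _ => Finset.sum_congr rfl fun j _ => by ring

/-- The rank one matrix with entries `v j * y i`. -/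
def rankOne {n k : ℕ} (v : EucSp k) (y : EucSp n) : EuclideanSpace ℝ (Fin k × Fin n) :=
  WithLp.toLp 2 fun p => v p.1 * y p.2

lemma inner_vecMulLin {n k : ℕ} (G : EuclideanSpace ℝ (Fin k × Fin n)) (v : EucSp k)
    (y : EucSp n) : ⟪vecMulLin G v, y⟫ = ⟪G, rankOne v y⟫ := by
  simp only [PiLp.inner_apply, vecMulLin_apply, rankOne, RCLike.inner_apply,
    conj_trivial, Finset.mul_sum]
  rw [Fintype.sum_prod_type, Finset.sum_comm]
  refine Finset.sum_congr rfl fun i _ => Finset.sum_congr rfl fun j _ => by ring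

lemma norm_rankOne {n k : ℕ} (v : EucSp k) (y : EucSp n) : ‖rankOne v y‖ = ‖v‖ * ‖y‖ := by
  rw [← abs_of_nonneg (norm_nonneg (rankOne v y)), ← abs_of_nonneg (by positivity : 0 ≤ ‖v‖ * ‖y‖),
    ← sq_eq_sq_iff_abs_eq_abs, mul_pow]
  simp only [EuclideanSpace.real_norm_sq_eq, rankOne]
  rw [Fintype.sum_prod_type, Finset.sum_mul_sum]
  simp only [mul_pow]

lemma continuous_vecMulLin {n k : ℕ} :
    Continuous fun p : EuclideanSpace ℝ (Fin k × Fin n) × EucSp k => vecMulLin p.1 p.2 := by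
  refine (PiLp.continuous_toLp 2 _).comp (continuous_pi fun i => ?_)
  fun_prop

lemma IsIsotropic.lintegral_norm_mulColLin_sq {n k : ℕ} {μ : Measure (EucSp n)}
    (hμ : IsIsotropic μ) (G : EuclideanSpace ℝ (Fin k × Fin n)) :
    ∫⁻ x, ENNReal.ofReal (‖mulColLin G x‖ ^ 2) ∂μ = ENNReal.ofReal (‖G‖ ^ 2) := by
  let r : Fin k → EucSp n := fun j => WithLp.toLp 2 fun i => G (j, i)
  have h1 : ∀ x, ENNReal.ofReal (‖mulColLin G x‖ ^ 2) =
      ∑ j, ENNReal.ofReal (⟪x, r j⟫ ^ 2) := by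
    intro x
    rw [EuclideanSpace.real_norm_sq_eq, ENNReal.ofReal_sum_of_nonneg fun j _ => sq_nonneg _]
    simp only [mulColLin_apply, PiLp.inner_apply, r, RCLike.inner_apply, conj_trivial]
  simp_rw [h1]
  rw [lintegral_finsetSum _ fun j _ => by fun_prop]
  simp_rw [hμ.lintegral_inner_sq]
  rw [← ENNReal.ofReal_sum_of_nonneg fun j _ => sq_nonneg _]
  simp only [EuclideanSpace.real_norm_sq_eq, r]
  rw [Fintype.sum_prod_type]

lemma lintegral_volume_section_eq {n k : ℕ} {P : Set (EucSp n)} (hP : MeasurableSet P) :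
    ∫⁻ G, volume {v : EucSp k | vecMulLin G v ∈ P}
        ∂gaussMeasure (EuclideanSpace ℝ (Fin k × Fin n)) =
      ∫⁻ v : EucSp k, gaussMeasure (EucSp n) {g | ‖v‖ • g ∈ P} := by
  set F := EuclideanSpace ℝ (Fin k × Fin n)
  have hA : MeasurableSet {p : F × EucSp k | vecMulLin p.1 p.2 ∈ P} :=
    continuous_vecMulLin.measurable hP
  have h1 := Measure.prod_apply (μ := gaussMeasure F) (ν := (volume : Measure (EucSp k))) hA
  have h2 := Measure.prod_apply_symm (μ := gaussMeasure F) (ν := (volume : Measure (EucSp k))) hA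
  refine h1.symm.trans (h2.trans (lintegral_congr fun v => ?_))
  have hL : Measurable fun G : F => vecMulLin G v :=
    (continuous_vecMulLin.comp (continuous_id.prodMk continuous_const)).measurable
  have h3 := gaussMeasure_map_eq_map_smul hL (rankOne v) (fun G y => inner_vecMulLin G v y)
    (fun y => norm_rankOne v y)
  have h4 := congrArg (fun m => m P) h3
  simp only at h4
  rw [Measure.map_apply hL hP, Measure.map_apply (measurable_const_smul _) hP] at h4
  exact h4

lemma const_le_of_volume_laplaceSublevel_le {n k : ℕ} (hk : 1 ≤ k) (hkn : 2 * k ≤ n)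
    {μ : Measure (EucSp n)} [IsProbabilityMeasure μ] (heven : IsEvenMeasure μ)
    (hiso : IsIsotropic μ) (hlc : IsLogConcave μ) {t : ℝ} (hkt : (k : ℝ) ≤ t ^ 2)
    {w : ℝ} (hw : 0 < w) (hP : volume (laplaceSublevel μ t) ≤ ENNReal.ofReal (w ^ n)) :
    Real.exp (-1000000) / 256 / (48 * √n) ≤ 40 * w / √k := by
  have hn : 1 ≤ n := by lia
  have hn0 : (0 : ℝ) < n := by exact_mod_cast hn
  have hk0 : (0 : ℝ) < k := by exact_mod_cast hk
  set a := Real.exp (-1000000) / 256 / (48 * √n) with ha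
  have ha0 : 0 < a := by positivity
  set F := EuclideanSpace ℝ (Fin k × Fin n)
  have hfin : Module.finrank ℝ F = k * n := by simp [F]
  have h1 := gaussMeasure_closedBall_ge (E := F) (by rw [hfin]; nlinarith)
  rw [hfin] at h1
  have h2 : ENNReal.ofReal (19 / 20) * ENNReal.ofReal (a ^ k) ≤
      ∫⁻ G, volume {v : EucSp k | vecMulLin G v ∈ laplaceSublevel μ t} ∂gaussMeasure F := by
    refine (mul_le_mul_left h1 _).trans ?_
    rw [mul_comm, ← setLIntegral_const]
    refine le_trans ?_ (setLIntegral_le_lintegral (Metric.closedBall 0 (4 * √((k * n : ℕ) : ℝ))) _)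
    refine setLIntegral_mono' Metric.isClosed_closedBall.measurableSet fun G hG => ?_
    refine volume_preimage_laplaceSublevel_ge hn hk heven hlc hkt (vecMulLin G) (mulColLin G)
      (inner_mulColLin G) ?_
    rw [hiso.lintegral_norm_mulColLin_sq]
    refine ENNReal.ofReal_le_ofReal ?_
    rw [mem_closedBall_zero_iff] at hG
    have := pow_le_pow_left₀ (norm_nonneg _) hG 2
    rw [mul_pow, Real.sq_sqrt (by positivity)] at this
    push_cast at this
    linarith
  rw [lintegral_volume_section_eq (measurableSet_laplaceSublevel μ t)] at h2
  have h3 := h2.trans (lintegral_gaussMeasure_preimage_smul_le hk hkn hw hP)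
  rw [← ENNReal.ofReal_mul (by norm_num), ENNReal.ofReal_le_ofReal_iff (by positivity)] at h3
  have hb : 0 ≤ 10 * w / √k := by positivity
  refine le_of_pow_le_pow_left₀ (n := k) (by lia) (by positivity) ?_
  have h4 : (40 * w / √k) ^ k = 4 ^ k * (10 * w / √k) ^ k := by
    rw [← mul_pow]; congr 1; ring
  rw [h4]
  have h5 : (4:ℝ) ≤ 4 ^ k := le_self_pow₀ (by norm_num) (by lia)
  have h6 : 4 * (10 * w / √k) ^ k ≤ 4 ^ k * (10 * w / √k) ^ k :=
    mul_le_mul_of_nonneg_right h5 (by positivity)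
  have h7 : 0 < a ^ k := by positivity
  linarith

lemma exists_nat_between_sq {n : ℕ} (hn : 2 ≤ n) {t : ℝ} (ht : 1 ≤ t) (htn : t ≤ √n) :
    ∃ k : ℕ, 1 ≤ k ∧ 2 * k ≤ n ∧ (k : ℝ) ≤ t ^ 2 ∧ t ^ 2 ≤ 4 * k := by
  have h1 : t ^ 2 ≤ n := by
    have := pow_le_pow_left₀ (by linarith) htn 2
    rwa [Real.sq_sqrt (by positivity)] at this
  rcases lt_or_ge (t ^ 2) 2 with h | h
  · exact ⟨1, le_rfl, by lia, by push_cast; nlinarith, by push_cast; linarith⟩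
  · have h2 := Nat.floor_le (a := t ^ 2 / 2) (by positivity)
    have h3 := Nat.lt_floor_add_one (t ^ 2 / 2)
    have h4 : 1 ≤ ⌊t ^ 2 / 2⌋₊ := Nat.le_floor (by push_cast; linarith)
    have h5 : (1 : ℝ) ≤ ⌊t ^ 2 / 2⌋₊ := by exact_mod_cast h4
    refine ⟨_, h4, ?_, by linarith, by linarith⟩
    have : (2 * ⌊t ^ 2 / 2⌋₊ : ℝ) ≤ n := by linarith
    exact_mod_cast this

lemma lt_volume_laplaceSublevel {n : ℕ} (hn : 1 ≤ n) {μ : Measure (EucSp n)}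
    [IsProbabilityMeasure μ] (heven : IsEvenMeasure μ) (hiso : IsIsotropic μ)
    (hlc : IsLogConcave μ) {t : ℝ} (ht : 1 ≤ t) (htn : t ≤ √n) :
    ENNReal.ofReal ((Real.exp (-1000000) / 256 / 4000 * t / √n) ^ n) <
      volume (laplaceSublevel μ t) := by
  have hn0 : (0 : ℝ) < n := by exact_mod_cast hn
  set c := Real.exp (-1000000) / 256 with hc
  have hc0 : 0 < c := by positivity
  rcases hn.eq_or_lt with rfl | hn2
  · have ht1 : t = 1 := le_antisymm (by simpa using htn) ht
    have h := volume_preimage_laplaceSublevel_ge (k := 1) le_rfl le_rfl heven hlc (t := t)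
      (by simp [ht1]) LinearMap.id LinearMap.id (fun _ _ => rfl) (by
        have h1 : ∀ x : EucSp 1, ‖x‖ ^ 2 = ⟪x, EuclideanSpace.single 0 1⟫ ^ 2 := by
          intro x
          rw [EuclideanSpace.real_norm_sq_eq]
          simp [EuclideanSpace.inner_single_right]
        simp only [LinearMap.id_apply, h1]
        rw [hiso.lintegral_inner_sq]
        refine ENNReal.ofReal_le_ofReal ?_
        simp)
    refine lt_of_lt_of_le ?_ h
    rw [ENNReal.ofReal_lt_ofReal_iff (by positivity), ht1]
    simp only [Nat.cast_one, Real.sqrt_one, pow_one]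
    linarith
  · by_contra! hcon
    obtain ⟨k, hk, hkn, hkt, hkt'⟩ := exists_nat_between_sq hn2 ht htn
    have hk0 : (0 : ℝ) < k := by exact_mod_cast hk
    have h := const_le_of_volume_laplaceSublevel_le hk hkn heven hiso hlc hkt
      (by positivity) hcon
    have hsk : t ≤ 2 * √k := by
      refine le_of_pow_le_pow_left₀ two_ne_zero (by positivity) ?_
      rw [mul_pow, Real.sq_sqrt hk0.le]; linarith
    have hs0 : 0 < √(n : ℝ) := by positivity
    have hsk0 : 0 < √(k : ℝ) := by positivity
    rw [← hc, div_le_div_iff₀ (by positivity) hsk0] at h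
    have h8 : 40 * (c / 4000 * t / √n) * (48 * √n) = c * t * (48 / 100) := by
      field_simp; norm_num
    rw [h8] at h
    nlinarith

/-- There is a universal constant c > 0 with the following property. Let μ be an even,
isotropic, log-concave probability measure on ℝⁿ, let 1 ≤ t ≤ √n and let
K_t = { ξ : Λ_μ(2ξ) ≤ t² } (the logarithmic Laplace transform possibly being +∞,
the condition is expressed as ∫ exp(2ξ·x) dμ ≤ exp(t²)). Then
Vol_n(K_t)^{1/n} ≥ c t / √n. -/
theorem volume_sublevel_logLaplace_lower_bound :
    ∃ c : ℝ, 0 < c ∧ ∀ n : ℕ, 1 ≤ n → ∀ μ : Measure (EucSp n),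
      IsProbabilityMeasure μ → IsEvenMeasure μ → IsIsotropic μ → IsLogConcave μ →
      ∀ t : ℝ, 1 ≤ t → t ≤ Real.sqrt n →
        c * t / Real.sqrt n ≤
          (volume {ξ : EucSp n |
              (∫⁻ x, ENNReal.ofReal (Real.exp ⟪(2:ℝ) • ξ, x⟫) ∂μ) ≤
                ENNReal.ofReal (Real.exp (t ^ 2))}).toReal ^ ((n : ℝ)⁻¹) := by
  refine ⟨Real.exp (-1000000) / 256 / 4000, by positivity, fun n hn μ _ heven hiso hlc t ht htn => ?_⟩
  have h := (lt_volume_laplaceSublevel hn heven hiso hlc ht htn).le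
  have htop := volume_laplaceSublevel_ne_top heven hiso t
  change _ ≤ (volume (laplaceSublevel μ t)).toReal ^ ((n : ℝ)⁻¹)
  rw [ENNReal.ofReal_le_iff_le_toReal htop] at h
  have h2 := Real.rpow_le_rpow (by positivity) h (by positivity : 0 ≤ (n : ℝ)⁻¹)
  rwa [Real.pow_rpow_inv_natCast (by positivity) (by lia)] at h2
end
end
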